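/- arXiv:2107.02240 — 3 statements merged into one kernel-verified Lean document; each statement's English description precedes it below -/
import Mathlib

section
/- Let T ∈ M_{m,n}(F_q) be a matrix of rank one, and let 0 ≤ k ≤ m ≤ n. Then the Fourier transform of the indicator function of the set of rank-k matrices, evaluated at T, satisfies the exact formula \widehat{1}_{(M_{m,n})_k}(T) = (q^{n+m-k} − q^n − q^m + 1) · (#Γ_{n,k} · #Γ_{m,k} · #GL_k) / ((q^n − 1)(q^m − 1)). In particular this value is positive if k < m and negative if k = m (for k ≥ 1). -/
open Matrix
open scoped BigOperators Classical

/-- The number of `k`-dimensional `F`-subspaces of `F^n` (the Grassmannian cardinality `#Γ_{n,k}`). -/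
noncomputable def grassCard (F : Type) [Field F] [Fintype F] (n k : ℕ) : ℕ :=
  Nat.card {W : Submodule F (Fin n → F) // Module.finrank F W = k}

/-- The order of `GL_k(F_q)`, namely `∏_{a=0}^{k-1} (q^k − q^a)`. -/
def cardGL (q k : ℕ) : ℕ := ∏ a ∈ Finset.range k, (q ^ k - q ^ a)

/-- The Fourier transform of the indicator function of the set of rank-`k` matrices in
`M_{m,n}(F_q)`, evaluated at `B`:  `Σ_{A, rank A = k} ψ(−trace(Bᵀ A))`. -/
noncomputable def rankFT (F : Type) [Field F] [Fintype F] (ψ : AddChar F ℂ)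
    (m n k : ℕ) (B : Matrix (Fin m) (Fin n) F) : ℂ :=
  ∑ A ∈ Finset.univ.filter (fun A : Matrix (Fin m) (Fin n) F => A.rank = k),
    ψ (-(Bᵀ * A).trace)

open Module Submodule in
/-- Families spanning a given subspace correspond to families spanning the subspace itself. -/
def spanEqEquiv {K V ι : Type*} [Field K] [AddCommGroup V] [Module K V] (W : Submodule K V) :
    {s : ι → V // span K (Set.range s) = W} ≃ {s : ι → W // span K (Set.range s) = ⊤} where
  toFun s := ⟨fun i => ⟨s.1 i, s.2.le (subset_span ⟨i, rfl⟩)⟩, by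
    apply Submodule.map_injective_of_injective W.injective_subtype
    rw [map_span, ← Set.range_comp, map_subtype_top]
    exact s.2⟩
  invFun s := ⟨fun i => s.1 i, by
    have h := congrArg (Submodule.map W.subtype) s.2
    rw [map_span, ← Set.range_comp, map_subtype_top] at h
    exact h⟩
  left_inv _ := rfl
  right_inv _ := rfl

open Module Submodule in
/-- A linear equivalence transports spanning families. -/
def spanTopEquiv {K V V' ι : Type*} [Field K] [AddCommGroup V] [Module K V] [AddCommGroup V']
    [Module K V'] (e : V ≃ₗ[K] V') :
    {s : ι → V // span K (Set.range s) = ⊤} ≃ {s : ι → V' // span K (Set.range s) = ⊤} :=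
  (Equiv.arrowCongr (Equiv.refl ι) e.toEquiv).subtypeEquiv fun s => by
    have h : Set.range (Equiv.arrowCongr (Equiv.refl ι) e.toEquiv s) = e '' Set.range s := by
      rw [← Set.range_comp]; rfl
    rw [h, ← LinearEquiv.coe_coe e, ← map_span, LinearMap.map_eq_top_iff
      (LinearMap.range_eq_top.mpr e.surjective), LinearEquiv.ker, sup_bot_eq]

open Module Submodule in
theorem natCard_finrank_span_eq {K V ι : Type*} [Field K] [Finite K] [AddCommGroup V] [Module K V]
    [FiniteDimensional K V] [Finite ι] (k : ℕ) :
    Nat.card {s : ι → V // finrank K (span K (Set.range s)) = k} =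
      Nat.card {W : Submodule K V // finrank K W = k} *
        Nat.card {s : ι → Fin k → K // span K (Set.range s) = ⊤} := by
  have : Finite V := Module.finite_of_finite K
  have : Finite (Submodule K V) := Finite.of_injective _ (SetLike.coe_injective (A := Submodule K V))
  let g : {s : ι → V // finrank K (span K (Set.range s)) = k} →
      {W : Submodule K V // finrank K W = k} := fun s => ⟨span K (Set.range s.1), s.2⟩
  have fib (W : {W : Submodule K V // finrank K W = k}) :
      Nonempty ({s // g s = W} ≃ {s : ι → Fin k → K // span K (Set.range s) = ⊤}) := by
    obtain ⟨W, hW⟩ := W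
    have e : W ≃ₗ[K] (Fin k → K) := LinearEquiv.ofFinrankEq _ _ (by simpa using hW)
    refine ⟨Equiv.trans ?_ ((spanEqEquiv (ι := ι) W).trans (spanTopEquiv e))⟩
    exact
      { toFun := fun s => ⟨s.1.1, congrArg Subtype.val s.2⟩
        invFun := fun s => ⟨⟨s.1, by rw [s.2]; exact hW⟩, Subtype.ext s.2⟩
        left_inv := fun _ => rfl
        right_inv := fun _ => rfl }
  rw [← Nat.card_prod, ← Nat.card_congr (Equiv.sigmaFiberEquiv g)]
  exact Nat.card_congr ((Equiv.sigmaCongrRight fun W => (fib W).some).trans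
    (Equiv.sigmaEquivProd _ _))

open Module Submodule in
theorem natCard_finrank_span_eq_prod {K V : Type*} [Field K] [Fintype K] [AddCommGroup V]
    [Module K V] [FiniteDimensional K V] {k : ℕ} (hk : k ≤ finrank K V) :
    Nat.card {s : Fin k → V // finrank K (span K (Set.range s)) = k} =
      ∏ a ∈ Finset.range k, (Fintype.card K ^ finrank K V - Fintype.card K ^ a) := by
  have : Finite V := Module.finite_of_finite K
  rw [Finset.prod_range, ← card_linearIndependent hk]
  refine Nat.card_congr (Equiv.subtypeEquivRight fun s => ?_)
  rw [linearIndependent_iff_card_eq_finrank_span, Fintype.card_fin, Set.finrank, eq_comm]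

open Module Submodule in
theorem natCard_span_eq_top {K ι : Type*} [Field K] [Fintype ι] (k : ℕ) :
    Nat.card {s : ι → Fin k → K // span K (Set.range s) = ⊤} =
      Nat.card {s : Fin k → ι → K // finrank K (span K (Set.range s)) = k} := by
  refine Nat.card_congr ((Equiv.piComm _).subtypeEquiv fun s => ?_)
  have h₁ := rank_eq_finrank_span_row (Matrix.of s)
  have h₂ := rank_eq_finrank_span_row (Matrix.of s)ᵀ
  rw [rank_transpose, h₁] at h₂
  have h₃ : finrank K (span K (Set.range (Equiv.piComm (fun _ _ => K) s))) =
    finrank K (span K (Set.range s)) := h₂.symm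
  rw [h₃]
  refine ⟨fun h => by rw [h, finrank_top, finrank_fin_fun], fun h => eq_top_of_finrank_eq ?_⟩
  rw [h, finrank_fin_fun]

open Module Submodule in
theorem grassCard_mul_cardGL (F : Type) [Field F] [Fintype F] (n k : ℕ) :
    grassCard F n k * cardGL (Fintype.card F) k =
      Nat.card {s : Fin k → Fin n → F // finrank F (span F (Set.range s)) = k} := by
  rw [natCard_finrank_span_eq, natCard_span_eq_top, natCard_finrank_span_eq_prod (by simp),
    finrank_fin_fun]
  rfl

open Module Submodule in
theorem grassCard_pos (F : Type) [Field F] [Fintype F] {n k : ℕ} (hk : k ≤ n) :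
    0 < grassCard F n k * cardGL (Fintype.card F) k := by
  rw [grassCard_mul_cardGL, natCard_finrank_span_eq_prod (by simpa using hk), finrank_fin_fun]
  refine Finset.prod_pos fun a ha => Nat.sub_pos_of_lt ?_
  exact Nat.pow_lt_pow_right Fintype.one_lt_card ((Finset.mem_range.mp ha).trans_le hk)

theorem card_rank_eq (F : Type) [Field F] [Fintype F] (m n k : ℕ) :
    (Finset.univ.filter fun A : Matrix (Fin m) (Fin n) F => A.rank = k).card =
      grassCard F n k * grassCard F m k * cardGL (Fintype.card F) k := by
  rw [mul_assoc, grassCard_mul_cardGL, ← natCard_span_eq_top, grassCard,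
    ← natCard_finrank_span_eq, ← Fintype.card_subtype, ← Nat.card_eq_fintype_card]
  exact Nat.card_congr (Equiv.subtypeEquivRight fun A => by rw [rank_eq_finrank_span_row]; rfl)

theorem sum_addChar_neg_dotProduct {F ι : Type*} [Field F] [Fintype F] [Fintype ι]
    [DecidableEq ι]
    {ψ : AddChar F ℂ} (hψ : ψ ≠ 1) (w : ι → F) :
    ∑ u : ι → F, ψ (-(u ⬝ᵥ w)) = if w = 0 then (Fintype.card F : ℂ) ^ Fintype.card ι else 0 := by
  split_ifs with hw
  · simp [hw]
  let φ : (ι → F) →+ F := AddMonoidHom.mk' (fun u => -(u ⬝ᵥ w)) fun a b => by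
    rw [add_dotProduct, neg_add]
  refine (AddChar.sum_eq_zero_iff_ne_zero (ψ := ψ.compAddMonoidHom φ)).mpr fun h => hψ ?_
  obtain ⟨i, hi⟩ := Function.ne_iff.mp hw
  ext x
  have := DFunLike.congr_fun h (Pi.single i (-x / w i))
  simpa [φ, neg_div, div_mul_cancel₀ x hi] using this

open Module in
theorem exists_linearEquiv_apply_eq {K V : Type*} [Field K] [AddCommGroup V] [Module K V]
    [FiniteDimensional K V] {u v : V} (hu : u ≠ 0) (hv : v ≠ 0) : ∃ e : V ≃ₗ[K] V, e u = v := by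
  obtain ⟨e, he⟩ := Submodule.exists_linearEquiv_restrict_eq
    ((LinearEquiv.toSpanNonzeroSingleton K V u hu).symm ≪≫ₗ
      LinearEquiv.toSpanNonzeroSingleton K V v hv)
  refine ⟨e, ?_⟩
  have h := he (LinearEquiv.toSpanNonzeroSingleton K V u hu 1)
  rw [LinearEquiv.trans_apply, LinearEquiv.symm_apply_apply] at h
  simpa only [LinearEquiv.toSpanNonzeroSingleton_apply, one_smul] using h.symm

theorem exists_isUnit_det_mulVec_eq {K ι : Type*} [Field K] [Fintype ι] [DecidableEq ι]
    {u v : ι → K} (hu : u ≠ 0) (hv : v ≠ 0) : ∃ P : Matrix ι ι K, IsUnit P.det ∧ P *ᵥ u = v := by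
  obtain ⟨e, he⟩ := exists_linearEquiv_apply_eq (K := K) hu hv
  refine ⟨LinearMap.toMatrix' e.toLinearMap, ?_, ?_⟩
  · rw [LinearMap.det_toMatrix']
    exact LinearEquiv.isUnit_det' e
  · rw [← toLin'_apply, toLin'_toMatrix']
    exact he

theorem exists_eq_vecMulVec_of_rank_eq_one {K ι κ : Type*} [Field K] [Fintype ι] [Fintype κ]
    {T : Matrix ι κ K} (hT : T.rank = 1) : ∃ u v, u ≠ 0 ∧ v ≠ 0 ∧ T = vecMulVec u v := by
  obtain ⟨w, -, hw⟩ := finrank_eq_one_iff'.mp hT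
  choose c hc using fun j => hw ⟨T *ᵥ Pi.single j 1, ⟨_, rfl⟩⟩
  have h : T = vecMulVec w.1 c := by
    ext i j
    have := congrFun (congrArg Subtype.val (hc j)) i
    simpa [vecMulVec_apply, mul_comm, col_apply] using this.symm
  have h0 : T ≠ 0 := by rintro rfl; simp at hT
  refine ⟨w, c, ?_, ?_, h⟩ <;> intro h' <;> apply h0 <;> rw [h, h'] <;> ext <;>
    simp [vecMulVec_apply]

/-- The sum over matrices of rank `k` of the character of a bilinear form value. -/
noncomputable def rankSum {F : Type} [Field F] [Fintype F] (ψ : AddChar F ℂ) {m n : ℕ} (k : ℕ)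
    (u : Fin m → F) (v : Fin n → F) : ℂ :=
  ∑ A ∈ Finset.univ.filter (fun A : Matrix (Fin m) (Fin n) F => A.rank = k), ψ (-(u ⬝ᵥ A *ᵥ v))

section

variable {F : Type} [Field F] [Fintype F] {ψ : AddChar F ℂ} {m n : ℕ} (k : ℕ)

theorem rankFT_vecMulVec (u : Fin m → F) (v : Fin n → F) :
    rankFT F ψ m n k (vecMulVec u v) = rankSum ψ k u v := by
  refine Finset.sum_congr rfl fun A _ => ?_
  rw [transpose_vecMulVec, vecMulVec_mul, trace_vecMulVec, dotProduct_comm, dotProduct_mulVec]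

theorem rankSum_eq_of_ne_zero {u u' : Fin m → F} {v v' : Fin n → F} (hu : u ≠ 0) (hu' : u' ≠ 0)
    (hv : v ≠ 0) (hv' : v' ≠ 0) : rankSum ψ k u v = rankSum ψ k u' v' := by
  obtain ⟨P, hP, rfl⟩ := exists_isUnit_det_mulVec_eq hu' hu
  obtain ⟨Q, hQ, rfl⟩ := exists_isUnit_det_mulVec_eq hv' hv
  have hP' : IsUnit Pᵀ.det := by rwa [det_transpose]
  refine Finset.sum_bij' (fun A _ => Pᵀ * A * Q) (fun A _ => Pᵀ⁻¹ * A * Q⁻¹) ?_ ?_ ?_ ?_ ?_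
  · intro A hA
    simpa [rank_mul_eq_left_of_isUnit_det _ _ hQ, rank_mul_eq_right_of_isUnit_det _ _ hP'] using hA
  · intro A hA
    have hQ' := Matrix.isUnit_nonsing_inv_det Q hQ
    have hP'' := Matrix.isUnit_nonsing_inv_det Pᵀ hP'
    simpa [rank_mul_eq_left_of_isUnit_det _ _ hQ', rank_mul_eq_right_of_isUnit_det _ _ hP'']
      using hA
  · intro A _
    simp only [Matrix.mul_assoc]
    rw [mul_nonsing_inv _ hQ, Matrix.mul_one, nonsing_inv_mul_cancel_left _ _ hP']
  · intro A _
    simp only [Matrix.mul_assoc]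
    rw [nonsing_inv_mul _ hQ, Matrix.mul_one, mul_nonsing_inv_cancel_left _ _ hP']
  · intro A _
    congr 2
    rw [← mulVec_mulVec, ← mulVec_mulVec, dotProduct_mulVec u' Pᵀ, vecMul_transpose]

theorem card_mulVec_eq_zero (A : Matrix (Fin m) (Fin n) F) :
    (Finset.univ.filter fun v => A *ᵥ v = 0).card = Fintype.card F ^ (n - A.rank) := by
  have h := LinearMap.finrank_range_add_finrank_ker A.mulVecLin
  rw [Module.finrank_fin_fun] at h
  have h' : n - A.rank = Module.finrank F (LinearMap.ker A.mulVecLin) := by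
    rw [rank]; omega
  rw [h', ← Module.card_eq_pow_finrank, ← Fintype.card_subtype]
  exact Fintype.card_congr (Equiv.subtypeEquivRight fun v => by simp)

theorem sum_rankSum (hψ : ψ ≠ 1) :
    ∑ u : Fin m → F, ∑ v : Fin n → F, rankSum ψ k u v =
      (Finset.univ.filter fun A : Matrix (Fin m) (Fin n) F => A.rank = k).card *
        (Fintype.card F : ℂ) ^ (m + (n - k)) := by
  have h : ∀ A ∈ Finset.univ.filter (fun A : Matrix (Fin m) (Fin n) F => A.rank = k),
      ∑ v : Fin n → F, ∑ u : Fin m → F, ψ (-(u ⬝ᵥ A *ᵥ v)) =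
        (Fintype.card F : ℂ) ^ (m + (n - k)) := by
    intro A hA
    obtain rfl := (Finset.mem_filter.mp hA).2
    simp_rw [sum_addChar_neg_dotProduct hψ]
    rw [← Finset.sum_filter, Finset.sum_const, card_mulVec_eq_zero, nsmul_eq_mul, Fintype.card_fin,
      pow_add, mul_comm, Nat.cast_pow]
  rw [← nsmul_eq_mul, ← Finset.sum_const, ← Finset.sum_congr rfl h]
  simp only [rankSum]
  rw [Finset.sum_comm]
  exact (Finset.sum_congr rfl fun v _ => Finset.sum_comm).trans Finset.sum_comm

theorem rankSum_zero_left (v : Fin n → F) : rankSum ψ k (0 : Fin m → F) v =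
    (Finset.univ.filter fun A : Matrix (Fin m) (Fin n) F => A.rank = k).card := by
  simp [rankSum]

theorem rankSum_zero_right (u : Fin m → F) : rankSum ψ k u (0 : Fin n → F) =
    (Finset.univ.filter fun A : Matrix (Fin m) (Fin n) F => A.rank = k).card := by
  simp [rankSum]

theorem rankSum_mul_eq (hψ : ψ ≠ 1) {u : Fin m → F} {v : Fin n → F} (hu : u ≠ 0) (hv : v ≠ 0)
    (hk : k ≤ n) :
    ((Fintype.card F : ℂ) ^ m - 1) * (((Fintype.card F : ℂ) ^ n - 1) * rankSum ψ k u v) =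
      ((Fintype.card F : ℂ) ^ (n + m - k) - (Fintype.card F : ℂ) ^ n
          - (Fintype.card F : ℂ) ^ m + 1) *
        (Finset.univ.filter fun A : Matrix (Fin m) (Fin n) F => A.rank = k).card := by
  have hsum := sum_rankSum (m := m) (n := n) k hψ
  have hinner (u' : Fin m → F) (hu' : u' ≠ 0) : ∑ v' : Fin n → F, rankSum ψ k u' v' =
      (Finset.univ.filter fun A : Matrix (Fin m) (Fin n) F => A.rank = k).card +
        ((Fintype.card F : ℂ) ^ n - 1) * rankSum ψ k u v := by
    rw [← Finset.add_sum_erase _ _ (Finset.mem_univ 0), rankSum_zero_right,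
      Finset.sum_congr rfl fun v' hv' =>
        rankSum_eq_of_ne_zero k hu' hu (Finset.ne_of_mem_erase hv') hv]
    simp [Finset.card_erase_of_mem, Nat.cast_sub (Nat.one_le_pow n _ Fintype.card_pos)]
  rw [← Finset.add_sum_erase _ _ (Finset.mem_univ 0),
    Finset.sum_congr rfl fun u' hu' => hinner u' (Finset.ne_of_mem_erase hu')] at hsum
  simp only [rankSum_zero_left, Finset.sum_const, Finset.card_erase_of_mem, Finset.mem_univ,
    Finset.card_univ, Fintype.card_pi_const, nsmul_eq_mul, Nat.cast_pow,
    Nat.cast_sub (Nat.one_le_pow m _ (Fintype.card_pos (α := F))), Nat.cast_one] at hsum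
  rw [show n + m - k = m + (n - k) by omega]
  linear_combination hsum

end

/-- the exact value of the Fourier transform of the set of rank-`k`
matrices at a rank-one matrix `T`, its positivity for `k < m`, and its negativity
for `k = m` (with `k ≥ 1`). -/
theorem rankFT_at_rank_one (F : Type) [Field F] [Fintype F]
    (ψ : AddChar F ℂ) (hψ : ψ ≠ 1)
    (m n k : ℕ) (hkm : k ≤ m) (hmn : m ≤ n)
    (T : Matrix (Fin m) (Fin n) F) (hT : T.rank = 1) :
    rankFT F ψ m n k T =
      (((Fintype.card F : ℂ) ^ (n + m - k) - (Fintype.card F : ℂ) ^ n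
          - (Fintype.card F : ℂ) ^ m + 1)) *
        ((grassCard F n k * grassCard F m k * cardGL (Fintype.card F) k : ℕ) /
          (((Fintype.card F : ℂ) ^ n - 1) * ((Fintype.card F : ℂ) ^ m - 1)))
    ∧ (k < m → 0 < (rankFT F ψ m n k T).re)
    ∧ (k = m → 1 ≤ k → (rankFT F ψ m n k T).re < 0) := by
  have hF : (1 : ℝ) < Fintype.card F := by exact_mod_cast Fintype.one_lt_card (α := F)
  obtain ⟨u, v, hu, hv, rfl⟩ := exists_eq_vecMulVec_of_rank_eq_one hT
  have hm : m ≠ 0 := by rintro rfl; exact hu (Subsingleton.elim _ _)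
  have hn : n ≠ 0 := by omega
  have hqm : 0 < (Fintype.card F : ℝ) ^ m - 1 := sub_pos.mpr (one_lt_pow₀ hF hm)
  have hqn : 0 < (Fintype.card F : ℝ) ^ n - 1 := sub_pos.mpr (one_lt_pow₀ hF hn)
  have hqm' : (Fintype.card F : ℂ) ^ m - 1 ≠ 0 := by exact_mod_cast hqm.ne'
  have hqn' : (Fintype.card F : ℂ) ^ n - 1 ≠ 0 := by exact_mod_cast hqn.ne'
  have key := rankSum_mul_eq k hψ hu hv (hkm.trans hmn)
  rw [card_rank_eq] at key
  rw [rankFT_vecMulVec]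
  have hval : rankSum ψ k u v = (((Fintype.card F : ℂ) ^ (n + m - k) - (Fintype.card F : ℂ) ^ n
          - (Fintype.card F : ℂ) ^ m + 1)) *
        ((grassCard F n k * grassCard F m k * cardGL (Fintype.card F) k : ℕ) /
          (((Fintype.card F : ℂ) ^ n - 1) * ((Fintype.card F : ℂ) ^ m - 1))) := by
    field_simp
    linear_combination key
  have hre : (rankSum ψ k u v).re = (((Fintype.card F : ℝ) ^ (n + m - k) - (Fintype.card F : ℝ) ^ n
          - (Fintype.card F : ℝ) ^ m + 1)) *
        ((grassCard F n k * grassCard F m k * cardGL (Fintype.card F) k : ℕ) /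
          (((Fintype.card F : ℝ) ^ n - 1) * ((Fintype.card F : ℝ) ^ m - 1))) := by
    rw [hval, ← Complex.ofReal_re (_ * _)]
    push_cast
    rfl
  have hN : 0 < grassCard F n k * grassCard F m k * cardGL (Fintype.card F) k := by
    have h₁ := grassCard_pos F hkm
    have h₂ := Nat.pos_of_mul_pos_right (grassCard_pos F (hkm.trans hmn))
    rw [mul_assoc]
    positivity
  have hpos : (0 : ℝ) < (grassCard F n k * grassCard F m k * cardGL (Fintype.card F) k : ℕ) /
      (((Fintype.card F : ℝ) ^ n - 1) * ((Fintype.card F : ℝ) ^ m - 1)) :=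
    div_pos (by exact_mod_cast hN) (mul_pos hqn hqm)
  refine ⟨hval, fun hk => ?_, ?_⟩
  · rw [hre]
    refine mul_pos ?_ hpos
    have h₁ : (Fintype.card F : ℝ) ^ (n + 1) ≤ (Fintype.card F : ℝ) ^ (n + m - k) :=
      pow_le_pow_right₀ hF.le (by omega)
    have h₂ : (Fintype.card F : ℝ) ^ m ≤ (Fintype.card F : ℝ) ^ n := pow_le_pow_right₀ hF.le hmn
    have h₃ : (2 : ℝ) ≤ Fintype.card F := by exact_mod_cast Fintype.one_lt_card (α := F)
    rw [pow_succ] at h₁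
    nlinarith
  · rintro rfl -
    rw [hre, Nat.add_sub_cancel]
    exact mul_neg_of_neg_of_pos (by linarith) hpos
end

section
/- Let ρ be a finite-dimensional complex representation of GL_n(F_q), n ≥ 2, and let m = ⌊n/2⌋. For B, B' ∈ M_{m,n−m}(F_q) with rank(B) = rank(B'), the characters ψ_B and ψ_{B'} occur with the same multiplicity in the restriction of ρ to U; equivalently, Σ_{A ∈ M_{m,n−m}(F_q)} χ_ρ(u(A)) · ψ(−trace(Bᵀ A)) = Σ_{A ∈ M_{m,n−m}(F_q)} χ_ρ(u(A)) · ψ(−trace(B'ᵀ A)). -/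
open Matrix CategoryTheory
open scoped BigOperators

/-- The reindexing equivalence `Fin (n/2) ⊕ Fin (n − n/2) ≃ Fin n`. -/
def blockEquiv (n : ℕ) : (Fin (n / 2) ⊕ Fin (n - n / 2)) ≃ Fin n :=
  finSumFinEquiv.trans (finCongr (by omega))

/-- The block unipotent matrix `u(A) = [[I, A], [0, I]]`, viewed as an `n × n` matrix. -/
def uMat (F : Type) [Field F] (n : ℕ)
    (A : Matrix (Fin (n / 2)) (Fin (n - n / 2)) F) : Matrix (Fin n) (Fin n) F :=
  (Matrix.fromBlocks 1 A 0 1).submatrix (blockEquiv n).symm (blockEquiv n).symm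

lemma uMat_det (F : Type) [Field F] [Fintype F] (n : ℕ)
    (A : Matrix (Fin (n / 2)) (Fin (n - n / 2)) F) : (uMat F n A).det = 1 := by
  unfold uMat
  rw [Matrix.det_submatrix_equiv_self, Matrix.det_fromBlocks_zero₂₁]
  simp

/-- The block unipotent matrix `u(A)` as an element of `GL_n(F_q)`. -/
noncomputable def uGL (F : Type) [Field F] [Fintype F] (n : ℕ)
    (A : Matrix (Fin (n / 2)) (Fin (n - n / 2)) F) : GL (Fin n) F :=
  Matrix.GeneralLinearGroup.mkOfDetNeZero (uMat F n A)
    (by rw [uMat_det]; exact one_ne_zero)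

/-- Over a field, two linear maps between finite-dimensional spaces whose ranges have the same
dimension are equivalent. -/
theorem LinearMap.exists_linearEquiv_of_finrank_range_eq {K V W : Type*} [Field K]
    [AddCommGroup V] [Module K V] [FiniteDimensional K V]
    [AddCommGroup W] [Module K W] [FiniteDimensional K W] (f g : V →ₗ[K] W)
    (h : Module.finrank K (LinearMap.range f) = Module.finrank K (LinearMap.range g)) :
    ∃ (e₁ : V ≃ₗ[K] V) (e₂ : W ≃ₗ[K] W), g = e₂.toLinearMap ∘ₗ f ∘ₗ e₁.toLinearMap := by
  obtain ⟨Cf, hCf⟩ := (LinearMap.ker f).exists_isCompl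
  obtain ⟨Cg, hCg⟩ := (LinearMap.ker g).exists_isCompl
  obtain ⟨Df, hDf⟩ := (LinearMap.range f).exists_isCompl
  obtain ⟨Dg, hDg⟩ := (LinearMap.range g).exists_isCompl
  let eR := LinearEquiv.ofFinrankEq _ _ h
  let eC := g.kerComplementEquivRange hCg.symm ≪≫ₗ eR.symm ≪≫ₗ
    (f.kerComplementEquivRange hCf.symm).symm
  let eK : LinearMap.ker g ≃ₗ[K] LinearMap.ker f := LinearEquiv.ofFinrankEq _ _ (by
    have := f.finrank_range_add_finrank_ker
    have := g.finrank_range_add_finrank_ker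
    omega)
  let eD : Df ≃ₗ[K] Dg := LinearEquiv.ofFinrankEq _ _ (by
    have := Submodule.finrank_add_eq_of_isCompl hDf
    have := Submodule.finrank_add_eq_of_isCompl hDg
    omega)
  let e₁ := (Submodule.prodEquivOfIsCompl _ _ hCg).symm ≪≫ₗ (eK.prodCongr eC) ≪≫ₗ
    Submodule.prodEquivOfIsCompl _ _ hCf
  let e₂ := (Submodule.prodEquivOfIsCompl _ _ hDf).symm ≪≫ₗ (eR.prodCongr eD) ≪≫ₗ
    Submodule.prodEquivOfIsCompl _ _ hDg
  have he₂ (y : LinearMap.range f) : e₂ y = eR y := by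
    simp [e₂]
  have hfC (c : Cg) : f (eC c) = (eR.symm (g.kerComplementEquivRange hCg.symm c) : W) := by
    have := congrArg Subtype.val ((f.kerComplementEquivRange hCf.symm).apply_symm_apply
      (eR.symm (g.kerComplementEquivRange hCg.symm c)))
    exact this
  refine ⟨e₁, e₂, LinearMap.ext fun x => ?_⟩
  obtain ⟨⟨k, c⟩, rfl⟩ := (Submodule.prodEquivOfIsCompl _ _ hCg).surjective x
  have hk : g k = 0 := k.2
  have hk' : f (eK k) = 0 := (eK k).2
  simp only [LinearMap.comp_apply, LinearEquiv.coe_coe]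
  have h₁ : e₁ (Submodule.prodEquivOfIsCompl _ _ hCg (k, c)) = (eK k : V) + (eC c : V) := by
    simp only [e₁, LinearEquiv.trans_apply, LinearEquiv.symm_apply_apply]
    simp
  rw [h₁, map_add, hk', zero_add, hfC, he₂, LinearEquiv.apply_symm_apply]
  simp [hk]

/-- The invertible matrix of a linear automorphism of `n → K`. -/
theorem LinearEquiv.exists_generalLinearGroup_toMatrix' {K n : Type*} [Field K] [Fintype n]
    [DecidableEq n] (e : (n → K) ≃ₗ[K] (n → K)) :
    ∃ P : GL n K, (P : Matrix n n K) = LinearMap.toMatrix' e.toLinearMap :=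
  ⟨⟨LinearMap.toMatrix' e.toLinearMap, LinearMap.toMatrix' e.symm.toLinearMap,
    by simp [← LinearMap.toMatrix'_comp], by simp [← LinearMap.toMatrix'_comp]⟩, rfl⟩

/-- Over a field, matrices of the same size and rank are equivalent. -/
theorem Matrix.exists_eq_mul_mul_of_rank_eq {K m n : Type*} [Field K] [Fintype m] [DecidableEq m]
    [Fintype n] [DecidableEq n] (B B' : Matrix m n K) (h : B.rank = B'.rank) :
    ∃ (P : GL m K) (Q : GL n K), B' = (P : Matrix m m K) * B * (Q : Matrix n n K) := by
  obtain ⟨e₁, e₂, he⟩ :=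
    LinearMap.exists_linearEquiv_of_finrank_range_eq (toLin' B) (toLin' B') h
  obtain ⟨Q, hQ⟩ := e₁.exists_generalLinearGroup_toMatrix'
  obtain ⟨P, hP⟩ := e₂.exists_generalLinearGroup_toMatrix'
  refine ⟨P, Q, ?_⟩
  have := congrArg LinearMap.toMatrix' he
  rwa [LinearMap.toMatrix'_comp, LinearMap.toMatrix'_comp, LinearMap.toMatrix'_toLin',
    LinearMap.toMatrix'_toLin', ← hP, ← hQ, ← Matrix.mul_assoc] at this

/-- The block-diagonal element `[[P, 0], [0, Q]]` of `GL_n(F_q)`. -/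
def blockDiagGL (F : Type) [Field F] (n : ℕ) (P : GL (Fin (n / 2)) F)
    (Q : GL (Fin (n - n / 2)) F) : GL (Fin n) F where
  val := (fromBlocks P.val 0 0 Q.val).submatrix (blockEquiv n).symm (blockEquiv n).symm
  inv := (fromBlocks P.inv 0 0 Q.inv).submatrix (blockEquiv n).symm (blockEquiv n).symm
  val_inv := by simp [submatrix_mul_equiv, fromBlocks_multiply]
  inv_val := by simp [submatrix_mul_equiv, fromBlocks_multiply]

/-- Conjugation by a block-diagonal element acts on `U` by `A ↦ P A Q⁻¹`. -/
theorem blockDiagGL_conj_uGL (F : Type) [Field F] [Fintype F] (n : ℕ) (P : GL (Fin (n / 2)) F)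
    (Q : GL (Fin (n - n / 2)) F) (A : Matrix (Fin (n / 2)) (Fin (n - n / 2)) F) :
    blockDiagGL F n P Q * uGL F n A * (blockDiagGL F n P Q)⁻¹ =
      uGL F n (P.val * A * Q⁻¹.val) := by
  rw [mul_inv_eq_iff_eq_mul]
  apply Units.ext
  change (fromBlocks P.val 0 0 Q.val).submatrix _ _ * uMat F n A =
    uMat F n _ * (fromBlocks P.val 0 0 Q.val).submatrix _ _
  simp [uMat, submatrix_mul_equiv, fromBlocks_multiply, Matrix.mul_assoc, -coe_units_inv]

/-- The bijection `A ↦ P A Q` of the space of rectangular matrices. -/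
def Matrix.mulMulEquiv {K m n : Type*} [Field K] [Fintype m] [DecidableEq m]
    [Fintype n] [DecidableEq n] (P : GL m K) (Q : GL n K) : Matrix m n K ≃ Matrix m n K where
  toFun A := P.val * A * Q.val
  invFun A := P⁻¹.val * A * Q⁻¹.val
  left_inv A := by
    simp only [Matrix.mul_assoc, Units.mul_inv, Matrix.mul_one]
    rw [← Matrix.mul_assoc, Units.inv_mul, Matrix.one_mul]
  right_inv A := by
    simp only [Matrix.mul_assoc, Units.inv_mul, Matrix.mul_one]
    rw [← Matrix.mul_assoc, Units.mul_inv, Matrix.one_mul]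

/-- The transpose of an invertible matrix. -/
def Matrix.GeneralLinearGroup.transposeUnit {K m : Type*} [Field K] [Fintype m] [DecidableEq m]
    (P : GL m K) : GL m K where
  val := P.valᵀ
  inv := P.invᵀ
  val_inv := by rw [← transpose_mul, P.inv_val, transpose_one]
  inv_val := by rw [← transpose_mul, P.val_inv, transpose_one]

/-- for a finite-dimensional complex representation `ρ` of `GL_n(F_q)` and
`B, B' ∈ M_{m,n−m}(F_q)` (`m = ⌊n/2⌋`) of equal rank, the characters `ψ_B` and `ψ_{B'}`
occur with the same multiplicity in `ρ|_U`, i.e.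
`Σ_A χ_ρ(u(A)) ψ(−trace(Bᵀ A)) = Σ_A χ_ρ(u(A)) ψ(−trace(B'ᵀ A))`. -/
theorem multiplicity_depends_only_on_rank
    (n : ℕ) (hn : 2 ≤ n) (F : Type) [Field F] [Fintype F]
    (ψ : AddChar F ℂ) (hψ : ψ ≠ 1)
    (ρ : FDRep ℂ (GL (Fin n) F))
    (B B' : Matrix (Fin (n / 2)) (Fin (n - n / 2)) F) (hBB' : B.rank = B'.rank) :
    ∑ A : Matrix (Fin (n / 2)) (Fin (n - n / 2)) F,
        ρ.character (uGL F n A) * ψ (-(Bᵀ * A).trace) =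
      ∑ A : Matrix (Fin (n / 2)) (Fin (n - n / 2)) F,
        ρ.character (uGL F n A) * ψ (-(B'ᵀ * A).trace) := by
  obtain ⟨P, Q, rfl⟩ := Matrix.exists_eq_mul_mul_of_rank_eq B B' hBB'
  let R := GeneralLinearGroup.transposeUnit P
  let S := GeneralLinearGroup.transposeUnit Q
  symm
  refine Fintype.sum_equiv (Matrix.mulMulEquiv R S) _ _ fun A => ?_
  have hχ : ρ.character (uGL F n (R.val * A * S.val)) = ρ.character (uGL F n A) := by
    have h := blockDiagGL_conj_uGL F n R S⁻¹ A
    rw [inv_inv] at h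
    rw [← h, FDRep.char_conj]
  have htr : ((P.val * B * Q.val)ᵀ * A).trace = (Bᵀ * (R.val * A * S.val)).trace := by
    change _ = (Bᵀ * (P.valᵀ * A * Q.valᵀ)).trace
    rw [transpose_mul, transpose_mul, Matrix.mul_assoc, trace_mul_comm]
    simp only [Matrix.mul_assoc]
  change _ = ρ.character (uGL F n (R.val * A * S.val)) * ψ (-(Bᵀ * (R.val * A * S.val)).trace)
  rw [hχ, htr]
end

section
/- Fix n ≥ 3. There exists a constant A_n > 0, depending only on n, such that for every finite field F_q with q elements and every regular semisimple g ∈ SL_n(F_q) with det(g − I) ≠ 0, the number of n-tuples from the conjugacy class C of the transvection whose product is g satisfies | #(M_{n,g}) · #(SL_n(F_q)) / #(C)^n − 1 | ≤ A_n / q. -/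
open Matrix
open scoped BigOperators

/-- The transvection `T = I + E₁₂` as an element of `SL_n(F_q)` (for `n ≥ 3`). -/
def transvectionSL (F : Type) [Field F] (n : ℕ) (hn : 3 ≤ n) :
    Matrix.SpecialLinearGroup (Fin n) F :=
  ⟨Matrix.transvection ⟨0, by omega⟩ ⟨1, by omega⟩ 1,
    Matrix.det_transvection_of_ne _ _ (by simp) 1⟩

open Polynomial

/-- Evaluation of a polynomial at a matrix, applied to a fixed vector. -/
noncomputable def aevalMulVec {F : Type} [Field F] {ι : Type} [Fintype ι] [DecidableEq ι]
    (A : Matrix ι ι F) (v : ι → F) : F[X] →ₗ[F] (ι → F) where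
  toFun p := aeval A p *ᵥ v
  map_add' p q := by simp [add_mulVec]
  map_smul' a p := by simp [smul_mulVec]

/-- `v` is a cyclic vector of `A`: no proper `A`-invariant subspace contains it. -/
def IsCyclicVec {F : Type} [Field F] {ι : Type} [Fintype ι]
    (A : Matrix ι ι F) (v : ι → F) : Prop :=
  ∀ W : Submodule F (ι → F), (∀ w ∈ W, A *ᵥ w ∈ W) → v ∈ W → W = ⊤

section Cyclic

variable {F : Type} [Field F] {ι : Type} [Fintype ι] [DecidableEq ι]

theorem aevalMulVec_apply (A : Matrix ι ι F) (v : ι → F) (p : F[X]) :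
    aevalMulVec A v p = aeval A p *ᵥ v := rfl

theorem aevalMulVec_mul (A : Matrix ι ι F) (v : ι → F) (p q : F[X]) :
    aevalMulVec A v (p * q) = aeval A p *ᵥ aevalMulVec A v q := by
  simp [aevalMulVec_apply, mulVec_mulVec]

theorem aevalMulVec_X_mul (A : Matrix ι ι F) (v : ι → F) (q : F[X]) :
    aevalMulVec A v (X * q) = A *ᵥ aevalMulVec A v q := by
  simp [aevalMulVec_mul]

theorem aevalMulVec_C (A : Matrix ι ι F) (v : ι → F) (a : F) :
    aevalMulVec A v (C a) = a • v := by
  simp [aevalMulVec_apply, Algebra.algebraMap_eq_smul_one, smul_mulVec]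

theorem aevalMulVec_one (A : Matrix ι ι F) (v : ι → F) :
    aevalMulVec A v 1 = v := by
  simp [aevalMulVec_apply]

theorem aevalMulVec_mem (A : Matrix ι ι F) (v : ι → F) (W : Submodule F (ι → F))
    (hW : ∀ w ∈ W, A *ᵥ w ∈ W) (hv : v ∈ W) (p : F[X]) : aevalMulVec A v p ∈ W := by
  induction p using Polynomial.induction_on' with
  | add p q hp hq => rw [map_add]; exact W.add_mem hp hq
  | monomial k a =>
    induction k with
    | zero => rw [monomial_zero_left, aevalMulVec_C]; exact W.smul_mem _ hv
    | succ k ih =>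
      rw [← X_mul_monomial, aevalMulVec_X_mul]; exact hW _ ih

theorem isCyclicVec_iff_surjective (A : Matrix ι ι F) (v : ι → F) :
    IsCyclicVec A v ↔ Function.Surjective (aevalMulVec A v) := by
  constructor
  · intro h
    rw [← LinearMap.range_eq_top]
    refine h _ ?_ ⟨1, aevalMulVec_one A v⟩
    rintro _ ⟨p, rfl⟩
    exact ⟨X * p, aevalMulVec_X_mul A v p⟩
  · intro h W hW hv
    rw [eq_top_iff]
    intro w _
    obtain ⟨p, rfl⟩ := h w
    exact aevalMulVec_mem A v W hW hv p

theorem aevalMulVec_modByMonic (A : Matrix ι ι F) (v : ι → F) (p : F[X]) :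
    aevalMulVec A v (p %ₘ A.charpoly) = aevalMulVec A v p := by
  conv_rhs => rw [← modByMonic_add_div p A.charpoly]
  rw [map_add, mul_comm, aevalMulVec_mul]
  simp [aevalMulVec_apply, aeval_self_charpoly]

theorem degree_modByMonic_charpoly (A : Matrix ι ι F) (p : F[X]) :
    p %ₘ A.charpoly ∈ degreeLT F (Fintype.card ι) := by
  rw [mem_degreeLT]
  have := degree_modByMonic_lt p (charpoly_monic A)
  rwa [charpoly_degree_eq_dim] at this

theorem charpoly_dvd_of_degreeLT_injective (A : Matrix ι ι F) (v : ι → F)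
    (h : ∀ p ∈ degreeLT F (Fintype.card ι), aevalMulVec A v p = 0 → p = 0)
    (p : F[X]) (hp : aevalMulVec A v p = 0) : A.charpoly ∣ p := by
  rw [← modByMonic_eq_zero_iff_dvd (charpoly_monic A)]
  exact h _ (degree_modByMonic_charpoly A p) (by rw [aevalMulVec_modByMonic, hp])

theorem isCyclicVec_iff_charpoly_dvd (A : Matrix ι ι F) (v : ι → F) :
    IsCyclicVec A v ↔ ∀ p, aevalMulVec A v p = 0 → A.charpoly ∣ p := by
  rw [isCyclicVec_iff_surjective]
  set L : degreeLT F (Fintype.card ι) →ₗ[F] (ι → F) :=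
    (aevalMulVec A v).comp (degreeLT F (Fintype.card ι)).subtype with hL
  have hfin : Module.finrank F (degreeLT F (Fintype.card ι)) = Module.finrank F (ι → F) := by
    rw [(degreeLTEquiv F (Fintype.card ι)).finrank_eq]; simp
  have : FiniteDimensional F (degreeLT F (Fintype.card ι)) :=
    (degreeLTEquiv F (Fintype.card ι)).symm.finiteDimensional
  have hiff := LinearMap.injective_iff_surjective_of_finrank_eq_finrank hfin (f := L)
  constructor
  · intro h
    have hs : Function.Surjective L := by
      intro w
      obtain ⟨p, rfl⟩ := h w
      exact ⟨⟨_, degree_modByMonic_charpoly A p⟩, aevalMulVec_modByMonic A v p⟩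
    have hi := hiff.2 hs
    apply charpoly_dvd_of_degreeLT_injective
    intro p hp hp0
    have : (⟨p, hp⟩ : degreeLT F (Fintype.card ι)) = 0 := hi (by rw [map_zero]; exact hp0)
    simpa using this
  · intro h
    have hi : Function.Injective L := by
      rw [injective_iff_map_eq_zero]
      rintro ⟨p, hp⟩ hp0
      have hd : A.charpoly ∣ p := h p hp0
      rw [mem_degreeLT, ← charpoly_degree_eq_dim A] at hp
      exact Subtype.ext (eq_zero_of_dvd_of_degree_lt hd hp)
    intro w
    obtain ⟨p, hp⟩ := hiff.1 hi w
    exact ⟨p, hp⟩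

theorem exists_factor_of_not_isCyclicVec (A : Matrix ι ι F) (v : ι → F)
    (h : ¬ IsCyclicVec A v) :
    ∃ p ∈ UniqueFactorizationMonoid.factors A.charpoly,
      aevalMulVec A v (A.charpoly / p) = 0 := by
  classical
  rw [isCyclicVec_iff_charpoly_dvd] at h
  push Not at h
  obtain ⟨q, hq, hnd⟩ := h
  have hne : A.charpoly ≠ 0 := (charpoly_monic A).ne_zero
  set e := EuclideanDomain.gcd A.charpoly q with he
  have hev : aevalMulVec A v e = 0 := by
    rw [he, EuclideanDomain.gcd_eq_gcd_ab, map_add, mul_comm, aevalMulVec_mul,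
      mul_comm, aevalMulVec_mul, hq]
    simp [aevalMulVec_apply, aeval_self_charpoly]
  obtain ⟨b, hb⟩ := EuclideanDomain.gcd_dvd_left A.charpoly q
  rw [← he] at hb
  have hbu : ¬ IsUnit b := by
    intro hu
    apply hnd
    have h1 : A.charpoly ∣ e := by
      conv_lhs => rw [hb]
      exact (hu.mul_right_dvd).2 dvd_rfl
    exact h1.trans (EuclideanDomain.gcd_dvd_right A.charpoly q)
  have hb0 : b ≠ 0 := by rintro rfl; simp at hb; exact hne hb
  obtain ⟨p, hp, hpb⟩ := WfDvdMonoid.exists_irreducible_factor hbu hb0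
  obtain ⟨p', hp', hass⟩ := UniqueFactorizationMonoid.exists_mem_factors_of_dvd hne hp
    (hpb.trans ⟨e, by rw [mul_comm]; exact hb⟩)
  refine ⟨p', hp', ?_⟩
  obtain ⟨b', hb'⟩ := hass.symm.dvd.trans hpb
  have hp0 : p' ≠ 0 := (UniqueFactorizationMonoid.irreducible_of_factor p' hp').ne_zero
  have : A.charpoly / p' = b' * e := by
    conv_lhs => rw [hb, hb']
    rw [show e * (p' * b') = p' * (b' * e) by ring]
    exact mul_div_cancel_left₀ _ hp0
  rw [this, aevalMulVec_mul, hev, mulVec_zero]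

theorem card_factors_charpoly_le (A : Matrix ι ι F) :
    (UniqueFactorizationMonoid.factors A.charpoly).card ≤ Fintype.card ι := by
  classical
  have hne : A.charpoly ≠ 0 := (charpoly_monic A).ne_zero
  have h0 : ∀ p ∈ UniqueFactorizationMonoid.factors A.charpoly, 1 ≤ p.natDegree :=
    fun p hp => (UniqueFactorizationMonoid.irreducible_of_factor p hp).natDegree_pos
  have hass := UniqueFactorizationMonoid.factors_prod hne
  have hdeg := natDegree_eq_of_degree_eq (degree_eq_degree_of_associated hass)
  rw [charpoly_natDegree_eq_dim, natDegree_multiset_prod] at hdeg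
  · rw [← hdeg]
    have := Multiset.card_nsmul_le_sum (s := (UniqueFactorizationMonoid.factors
      A.charpoly).map natDegree) (a := 1) (by simpa using h0)
    simpa using this
  · intro h
    exact (UniqueFactorizationMonoid.irreducible_of_factor _ h).ne_zero rfl

theorem not_charpoly_dvd_div (A : Matrix ι ι F) {p : F[X]}
    (hp : p ∈ UniqueFactorizationMonoid.factors A.charpoly) :
    ¬ A.charpoly ∣ A.charpoly / p := by
  intro hdvd
  have hne : A.charpoly ≠ 0 := (charpoly_monic A).ne_zero
  have hirr := UniqueFactorizationMonoid.irreducible_of_factor p hp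
  have hpd := UniqueFactorizationMonoid.dvd_of_mem_factors hp
  obtain ⟨s, hs⟩ := hpd
  have hdiv : A.charpoly / p = s := by
    conv_lhs => rw [hs]
    exact mul_div_cancel_left₀ _ hirr.ne_zero
  rw [hdiv] at hdvd
  obtain ⟨t, ht⟩ := hdvd
  have hs0 : s ≠ 0 := by rintro rfl; simp at hs; exact hne hs
  apply hirr.not_isUnit
  have : s * (p * t) = s * 1 := by
    calc s * (p * t) = (p * s) * t := by ring
      _ = A.charpoly * t := by rw [← hs]
      _ = s * 1 := by rw [← ht, mul_one]
  exact IsUnit.of_mul_eq_one _ (mul_left_cancel₀ hs0 this)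

/-- Linear preimages of the set of non-cyclic vectors are small. -/
theorem ncard_not_isCyclicVec_le [Fintype F] (A : Matrix ι ι F) {κ : Type} [Fintype κ]
    (L : (κ → F) →ₗ[F] (ι → F))
    (hL : ∀ p ∈ UniqueFactorizationMonoid.factors A.charpoly,
      ∃ w, aevalMulVec A (L w) (A.charpoly / p) ≠ 0) :
    {w | ¬ IsCyclicVec A (L w)}.ncard ≤
      Fintype.card ι * Fintype.card F ^ (Fintype.card κ - 1) := by
  classical
  set S := (UniqueFactorizationMonoid.factors A.charpoly).toFinset
  let K : F[X] → Submodule F (κ → F) := fun p =>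
    LinearMap.ker ((mulVecLin (aeval A (A.charpoly / p))).comp L)
  have hsub : {w | ¬ IsCyclicVec A (L w)} ⊆ ⋃ p ∈ S, (K p : Set (κ → F)) := by
    intro w hw
    obtain ⟨p, hp, hpw⟩ := exists_factor_of_not_isCyclicVec A (L w) hw
    simp only [Set.mem_iUnion]
    exact ⟨p, by simpa [S] using hp, by simpa [K, aevalMulVec_apply] using hpw⟩
  have hK : ∀ p ∈ S, (K p : Set (κ → F)).ncard ≤ Fintype.card F ^ (Fintype.card κ - 1) := by
    intro p hp
    have hlt : Module.finrank F (K p) < Fintype.card κ := by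
      rw [← Module.finrank_fintype_fun_eq_card F (η := κ)]
      apply Submodule.finrank_lt
      obtain ⟨w, hw⟩ := hL p (by simpa [S] using hp)
      intro h
      apply hw
      have : w ∈ K p := by rw [h]; trivial
      simpa [K, aevalMulVec_apply] using this
    have : (K p : Set (κ → F)).ncard = Fintype.card F ^ Module.finrank F (K p) := by
      rw [← Nat.card_coe_set_eq, ← Nat.card_eq_fintype_card (α := F)]
      exact Module.natCard_eq_pow_finrank (K := F) (V := K p)
    rw [this]
    exact Nat.pow_le_pow_right Fintype.card_pos (by omega)
  calc _ ≤ (⋃ p ∈ S, (K p : Set (κ → F))).ncard := Set.ncard_le_ncard hsub (Set.toFinite _)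
    _ ≤ ∑ p ∈ S, (K p : Set (κ → F)).ncard := Finset.set_ncard_biUnion_le _ _
    _ ≤ ∑ p ∈ S, Fintype.card F ^ (Fintype.card κ - 1) := Finset.sum_le_sum hK
    _ = S.card * Fintype.card F ^ (Fintype.card κ - 1) := by simp
    _ ≤ _ := Nat.mul_le_mul_right _ ((Multiset.toFinset_card_le _).trans
        (card_factors_charpoly_le A))

theorem ncard_not_isCyclicVec_le_of_dvd [Fintype F] (A : Matrix ι ι F)
    (hA : ∀ p, aeval A p = 0 → A.charpoly ∣ p) :
    {w | ¬ IsCyclicVec A w}.ncard ≤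
      Fintype.card ι * Fintype.card F ^ (Fintype.card ι - 1) := by
  apply ncard_not_isCyclicVec_le A LinearMap.id
  intro p hp
  by_contra! h
  apply not_charpoly_dvd_div A hp
  apply hA
  rw [← Matrix.toLin'.map_eq_zero_iff]
  refine LinearMap.ext fun w => ?_
  rw [toLin'_apply]
  exact h w

theorem IsCyclicVec.charpoly_dvd {A : Matrix ι ι F} {v : ι → F} (h : IsCyclicVec A v)
    (p : F[X]) (hp : aeval A p = 0) : A.charpoly ∣ p :=
  (isCyclicVec_iff_charpoly_dvd A v).1 h p (by simp [aevalMulVec_apply, hp])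

theorem exists_smul_one_sub_aeval_eq_charmatrix_mul (A : Matrix ι ι F) (p : F[X]) :
    ∃ Q : Matrix ι ι F[X],
      p • (1 : Matrix ι ι F[X]) - (aeval A p).map C = charmatrix A * Q := by
  induction p using Polynomial.induction_on' with
  | add p q hp hq =>
    obtain ⟨P, hP⟩ := hp
    obtain ⟨Q, hQ⟩ := hq
    refine ⟨P + Q, ?_⟩
    rw [Matrix.mul_add, ← hP, ← hQ, map_add, Matrix.map_add (C : F →+* F[X]) (map_add C), add_smul]
    abel
  | monomial k a =>
    induction k with
    | zero =>
      refine ⟨0, ?_⟩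
      ext i j
      by_cases h : i = j <;> simp [h, Matrix.algebraMap_matrix_apply]
    | succ k ih =>
      obtain ⟨Q, hQ⟩ := ih
      refine ⟨(X : F[X]) • Q + (aeval A (monomial k a)).map (C : F →+* F[X]), ?_⟩
      have hc : charmatrix A = (X : F[X]) • (1 : Matrix ι ι F[X]) - A.map (C : F →+* F[X]) := by
        ext i j : 2
        by_cases h : i = j <;> simp [h]
      rw [Matrix.mul_add, Matrix.mul_smul, ← hQ, ← X_mul_monomial, map_mul, aeval_X,
        Matrix.map_mul, hc, Matrix.sub_mul, smul_sub, smul_mul, Matrix.one_mul, smul_smul]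
      abel

theorem charpoly_dvd_of_squarefree (A : Matrix ι ι F) (hA : Squarefree A.charpoly)
    (p : F[X]) (hp : aeval A p = 0) : A.charpoly ∣ p := by
  obtain ⟨Q, hQ⟩ := exists_smul_one_sub_aeval_eq_charmatrix_mul A p
  rw [hp, Matrix.map_zero _ (map_zero _), sub_zero] at hQ
  have hdet := congrArg det hQ
  rw [det_smul, det_one, mul_one, det_mul] at hdet
  have h1 : A.charpoly ∣ p ^ (Fintype.card ι + 1) :=
    (Dvd.intro _ hdet.symm).trans (pow_dvd_pow p (Nat.le_succ _))
  exact (hA.dvd_pow_iff_dvd (Nat.succ_ne_zero _)).1 h1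

/-- Matrices with the same characteristic polynomial and cyclic vectors are conjugate by a
matrix carrying one cyclic vector to the other. -/
theorem exists_intertwiner {A B : Matrix ι ι F} {v w : ι → F} (hA : IsCyclicVec A v)
    (hB : IsCyclicVec B w) (hAB : A.charpoly = B.charpoly) :
    ∃ U : Matrix ι ι F, U.det ≠ 0 ∧ U *ᵥ v = w ∧ U * A = B * U := by
  have hsA := (isCyclicVec_iff_surjective A v).1 hA
  have hdA := (isCyclicVec_iff_charpoly_dvd A v).1 hA
  obtain ⟨s, hs⟩ := LinearMap.exists_rightInverse_of_surjective _ (LinearMap.range_eq_top.2 hsA)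
  have hs' : ∀ x, aevalMulVec A v (s x) = x := fun x => LinearMap.congr_fun hs x
  set U := LinearMap.toMatrix' ((aevalMulVec B w).comp s) with hU
  have hUv : ∀ p, U *ᵥ aevalMulVec A v p = aevalMulVec B w p := by
    intro p
    rw [hU, LinearMap.toMatrix'_mulVec, LinearMap.comp_apply, ← sub_eq_zero, ← map_sub]
    obtain ⟨c, hc⟩ := hdA (s (aevalMulVec A v p) - p) (by rw [map_sub, hs', sub_self])
    rw [hc, mul_comm, aevalMulVec_mul, hAB]
    simp [aevalMulVec_apply, aeval_self_charpoly]
  refine ⟨U, ?_, ?_, ?_⟩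
  · have hsurj : Function.Surjective U.mulVec := by
      intro y
      obtain ⟨p, rfl⟩ := (isCyclicVec_iff_surjective B w).1 hB y
      exact ⟨_, hUv p⟩
    have := mulVec_surjective_iff_isUnit.1 hsurj
    exact ((Matrix.isUnit_iff_isUnit_det _).1 this).ne_zero
  · have := hUv 1
    rwa [aevalMulVec_one, aevalMulVec_one] at this
  · rw [← Matrix.toLin'.injective.eq_iff]
    refine LinearMap.ext fun x => ?_
    obtain ⟨p, rfl⟩ := hsA x
    have h1 := hUv (X * p)
    rw [aevalMulVec_X_mul, aevalMulVec_X_mul, ← hUv p, mulVec_mulVec, mulVec_mulVec] at h1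
    rwa [toLin'_apply, toLin'_apply]

theorem intertwiner_ext {A B U V : Matrix ι ι F} {v : ι → F} (hA : IsCyclicVec A v)
    (hU : U * A = B * U) (hV : V * A = B * V) (h : U *ᵥ v = V *ᵥ v) : U = V := by
  have := hA (LinearMap.ker (mulVecLin (U - V))) (by
    intro w hw
    rw [LinearMap.mem_ker, mulVecLin_apply] at hw ⊢
    rw [mulVec_mulVec, Matrix.sub_mul, hU, hV, ← Matrix.mul_sub, ← mulVec_mulVec, hw,
      mulVec_zero]) (by simp [h])
  rw [LinearMap.ker_eq_top] at this
  rw [← sub_eq_zero, ← Matrix.toLin'.map_eq_zero_iff]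
  exact this

theorem isCyclicVec_intertwiner {A B U : Matrix ι ι F} {v : ι → F} (hdet : U.det ≠ 0)
    (hU : U * A = B * U) : IsCyclicVec B (U *ᵥ v) ↔ IsCyclicVec A v := by
  have hinj : ∀ x, U *ᵥ x = 0 → x = 0 := fun x hx => by
    by_contra hne
    exact hdet (Matrix.exists_mulVec_eq_zero_iff.1 ⟨x, hne, hx⟩)
  have hu : IsUnit U := (Matrix.isUnit_iff_isUnit_det _).2 (isUnit_iff_ne_zero.2 hdet)
  have hch : A.charpoly = B.charpoly := by
    obtain ⟨u, rfl⟩ := hu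
    have : B = u.val * A * u⁻¹.val := by
      rw [hU, Matrix.mul_assoc, Units.mul_inv, Matrix.mul_one]
    rw [this, Matrix.coe_units_inv]
    exact (Matrix.charpoly_units_conj u A).symm
  have hev : ∀ p, aevalMulVec B (U *ᵥ v) p = U *ᵥ aevalMulVec A v p := by
    intro p
    induction p using Polynomial.induction_on' with
    | add p q hp hq => rw [map_add, map_add, mulVec_add, hp, hq]
    | monomial k a =>
      induction k with
      | zero => rw [monomial_zero_left, aevalMulVec_C, aevalMulVec_C, mulVec_smul]
      | succ k ih =>
        rw [← X_mul_monomial, aevalMulVec_X_mul, aevalMulVec_X_mul, ih, mulVec_mulVec,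
          mulVec_mulVec, hU]
  rw [isCyclicVec_iff_charpoly_dvd, isCyclicVec_iff_charpoly_dvd, hch]
  refine forall_congr' fun p => ?_
  rw [hev]
  constructor
  · intro h hp; exact h (by rw [hp, mulVec_zero])
  · intro h hp; exact h (hinj _ hp)

end Cyclic

/-- The block matrix with corner entry `d`, first row `(d, r)` and first column `(d, c)`. -/
def blk {F : Type} {m : ℕ} (d : F) (r c : Fin m → F) (A : Matrix (Fin m) (Fin m) F) :
    Matrix (Fin (m + 1)) (Fin (m + 1)) F :=
  of (Fin.cons (Fin.cons d r) fun i => Fin.cons (c i) (A i))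

section Block

variable {F : Type} {m : ℕ}

@[simp] theorem blk_zero_zero (d : F) (r c : Fin m → F) (A : Matrix (Fin m) (Fin m) F) :
    blk d r c A 0 0 = d := rfl

@[simp] theorem blk_zero_succ (d : F) (r c : Fin m → F) (A : Matrix (Fin m) (Fin m) F)
    (j : Fin m) : blk d r c A 0 j.succ = r j := rfl

@[simp] theorem blk_succ_zero (d : F) (r c : Fin m → F) (A : Matrix (Fin m) (Fin m) F)
    (i : Fin m) : blk d r c A i.succ 0 = c i := rfl

@[simp] theorem blk_succ_succ (d : F) (r c : Fin m → F) (A : Matrix (Fin m) (Fin m) F)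
    (i j : Fin m) : blk d r c A i.succ j.succ = A i j := rfl

theorem blk_inj {d d' : F} {r r' c c' : Fin m → F} {A A' : Matrix (Fin m) (Fin m) F} :
    blk d r c A = blk d' r' c' A' ↔ d = d' ∧ r = r' ∧ c = c' ∧ A = A' := by
  constructor
  · intro h
    refine ⟨congrFun (congrFun h 0) 0, funext fun j => congrFun (congrFun h 0) j.succ,
      funext fun i => congrFun (congrFun h i.succ) 0, ?_⟩
    ext i j
    exact congrFun (congrFun h i.succ) j.succ
  · rintro ⟨rfl, rfl, rfl, rfl⟩; rfl

variable [Field F]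

theorem blk_mulVec_cons (d : F) (r c : Fin m → F) (A : Matrix (Fin m) (Fin m) F) (x : F)
    (w : Fin m → F) :
    blk d r c A *ᵥ (Fin.cons x w : Fin (m + 1) → F) =
      Fin.cons (d * x + r ⬝ᵥ w) (x • c + A *ᵥ w) := by
  ext i
  refine Fin.cases ?_ (fun i => ?_) i <;>
    simp [mulVec, dotProduct, Fin.sum_univ_succ, mul_comm]

theorem blk_mul_blk (d d' : F) (r r' c c' : Fin m → F) (A A' : Matrix (Fin m) (Fin m) F) :
    blk d r c A * blk d' r' c' A' =
      blk (d * d' + r ⬝ᵥ c') (d • r' + r ᵥ* A') (d' • c + A *ᵥ c') (vecMulVec c r' + A * A') := by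
  ext i j
  refine Fin.cases ?_ (fun i => ?_) i <;> refine Fin.cases ?_ (fun j => ?_) j <;>
    simp [Matrix.mul_apply, Fin.sum_univ_succ, dotProduct, mulVec, vecMul, vecMulVec_apply,
      mul_comm]

theorem det_blk_row_zero (d : F) (c : Fin m → F) (A : Matrix (Fin m) (Fin m) F) :
    (blk d 0 c A).det = d * A.det := by
  rw [det_succ_row_zero, Fin.sum_univ_succ]
  have : (blk d 0 c A).submatrix Fin.succ Fin.succ = A := by
    ext i j; simp
  simp [this]

theorem det_blk_col_zero (d : F) (r : Fin m → F) (A : Matrix (Fin m) (Fin m) F) :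
    (blk d r 0 A).det = d * A.det := by
  rw [det_succ_column_zero, Fin.sum_univ_succ]
  have : (blk d r 0 A).submatrix Fin.succ Fin.succ = A := by
    ext i j; simp
  simp [this]

/-- The first standard basis vector. -/
abbrev firstVec (F : Type) [Field F] (m : ℕ) : Fin (m + 1) → F := Fin.cons 1 0

theorem cons_eq_smul_firstVec_add (x : F) (w : Fin m → F) :
    (Fin.cons x w : Fin (m + 1) → F) = x • firstVec F m + Fin.cons 0 w := by
  ext i
  refine Fin.cases ?_ (fun i => ?_) i <;> simp

/-- Prepending a zero coordinate, as a linear map. -/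
def consZero (F : Type) [Field F] (m : ℕ) : (Fin m → F) →ₗ[F] (Fin (m + 1) → F) where
  toFun w := Fin.cons 0 w
  map_add' v w := by ext i; refine Fin.cases ?_ (fun i => ?_) i <;> simp
  map_smul' a w := by ext i; refine Fin.cases ?_ (fun i => ?_) i <;> simp

@[simp] theorem consZero_apply (w : Fin m → F) : consZero F m w = Fin.cons 0 w := rfl

theorem isCyclicVec_blk_iff (d : F) (r c : Fin m → F) (A : Matrix (Fin m) (Fin m) F) :
    IsCyclicVec (blk d r c A) (firstVec F m) ↔ IsCyclicVec A c := by
  constructor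
  · intro h W hW hc
    have := h (W.comap (LinearMap.funLeft F F Fin.succ)) (by
      intro w hw
      rw [← Fin.cons_self_tail w] at hw ⊢
      rw [blk_mulVec_cons]
      exact W.add_mem (W.smul_mem _ hc) (hW _ hw)) (by
        exact W.zero_mem)
    rw [eq_top_iff]
    intro w _
    have hw : (Fin.cons 0 w : Fin (m + 1) → F) ∈
      W.comap (LinearMap.funLeft F F Fin.succ) := this ▸ Submodule.mem_top
    exact hw
  · intro h W hW h0
    have key := h (W.comap (consZero F m)) (by
      intro w hw
      have h1 := hW _ hw
      rwa [consZero_apply, blk_mulVec_cons, cons_eq_smul_firstVec_add,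
        Submodule.add_mem_iff_right _ (W.smul_mem _ h0), zero_smul, zero_add] at h1) (by
      have h1 := hW _ h0
      rwa [blk_mulVec_cons, cons_eq_smul_firstVec_add, Submodule.add_mem_iff_right _
        (W.smul_mem _ h0), one_smul, mulVec_zero, add_zero] at h1)
    rw [eq_top_iff]
    intro w _
    rw [← Fin.cons_self_tail w, cons_eq_smul_firstVec_add]
    refine W.add_mem (W.smul_mem _ h0) ?_
    have : Fin.tail w ∈ W.comap (consZero F m) := key ▸ Submodule.mem_top
    exact this

theorem mem_degreeLT_iff_coeff {k : ℕ} {p : F[X]} :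
    p ∈ degreeLT F k ↔ ∀ i, k ≤ i → p.coeff i = 0 := by
  rw [mem_degreeLT, degree_lt_iff_coeff_zero]

theorem divX_mem_degreeLT {k : ℕ} {p : F[X]} (hp : p ∈ degreeLT F (k + 1)) :
    p.divX ∈ degreeLT F k := by
  rw [mem_degreeLT_iff_coeff] at hp ⊢
  intro i hi
  rw [coeff_divX]
  exact hp _ (by omega)

theorem X_mul_add_C_mem_degreeLT {k : ℕ} {p : F[X]} (hp : p ∈ degreeLT F k) (a : F) :
    X * p + C a ∈ degreeLT F (k + 1) := by
  rw [mem_degreeLT_iff_coeff] at hp ⊢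
  intro i hi
  obtain ⟨j, rfl⟩ := Nat.exists_eq_add_of_le' (show 1 ≤ i by omega)
  rw [coeff_add, coeff_X_mul, coeff_C_succ, hp _ (by omega), zero_add]

theorem blk_mulVec_sub (d₁ d₂ : F) (r₁ r₂ c : Fin m → F) (A : Matrix (Fin m) (Fin m) F)
    (v : Fin (m + 1) → F) :
    blk d₁ r₁ c A *ᵥ v = blk d₂ r₂ c A *ᵥ v +
      ((Fin.cons (d₁ - d₂) (r₁ - r₂) : Fin (m + 1) → F) ⬝ᵥ v) • firstVec F m := by
  ext i
  refine Fin.cases ?_ (fun i => ?_) i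
  · simp [mulVec, dotProduct, Fin.sum_univ_succ, sub_mul, Finset.sum_sub_distrib]
    ring
  · simp [mulVec, dotProduct, Fin.sum_univ_succ]

theorem aevalMulVec_X_mul_divX (A : Matrix (Fin m) (Fin m) F) (v : Fin m → F) (p : F[X]) :
    aevalMulVec A v p = A *ᵥ aevalMulVec A v p.divX + p.coeff 0 • v := by
  conv_lhs => rw [← X_mul_divX_add p]
  rw [map_add, aevalMulVec_X_mul, aevalMulVec_C]

theorem exists_aevalMulVec_sub (d₁ d₂ : F) (r₁ r₂ c : Fin m → F) (A : Matrix (Fin m) (Fin m) F)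
    (k : ℕ) : ∀ p ∈ degreeLT F (k + 1), ∃ R ∈ degreeLT F k,
      aevalMulVec (blk d₁ r₁ c A) (firstVec F m) p - aevalMulVec (blk d₂ r₂ c A) (firstVec F m) p =
        aevalMulVec (blk d₂ r₂ c A) (firstVec F m) R := by
  induction k with
  | zero =>
    intro p hp
    refine ⟨0, Submodule.zero_mem _, ?_⟩
    have h0 : p.divX = 0 := by
      ext i
      exact mem_degreeLT_iff_coeff.1 (divX_mem_degreeLT hp) i (Nat.zero_le i)
    rw [aevalMulVec_X_mul_divX, aevalMulVec_X_mul_divX (blk d₂ r₂ c A), h0]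
    simp
  | succ k ih =>
    intro p hp
    obtain ⟨R, hR, h⟩ := ih _ (divX_mem_degreeLT hp)
    refine ⟨_, X_mul_add_C_mem_degreeLT hR ((Fin.cons (d₁ - d₂) (r₁ - r₂) : Fin (m + 1) → F) ⬝ᵥ
      aevalMulVec (blk d₁ r₁ c A) (firstVec F m) p.divX), ?_⟩
    rw [aevalMulVec_X_mul_divX, aevalMulVec_X_mul_divX (blk d₂ r₂ c A), blk_mulVec_sub d₁ d₂ r₁ r₂,
      map_add, aevalMulVec_X_mul, aevalMulVec_C, ← h, mulVec_sub]
    abel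

theorem aevalMulVec_divX_eq {d₁ d₂ : F} {r₁ r₂ c : Fin m → F} {A : Matrix (Fin m) (Fin m) F}
    (hc : IsCyclicVec A c) {p : F[X]} (hp : p ∈ degreeLT F (m + 2))
    (h : aevalMulVec (blk d₁ r₁ c A) (firstVec F m) p =
      aevalMulVec (blk d₂ r₂ c A) (firstVec F m) p) :
    aevalMulVec (blk d₁ r₁ c A) (firstVec F m) p.divX =
      aevalMulVec (blk d₂ r₂ c A) (firstVec F m) p.divX ∧
    (Fin.cons (d₁ - d₂) (r₁ - r₂) : Fin (m + 1) → F) ⬝ᵥ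
      aevalMulVec (blk d₁ r₁ c A) (firstVec F m) p.divX = 0 := by
  obtain ⟨R, hR, hRe⟩ := exists_aevalMulVec_sub d₁ d₂ r₁ r₂ c A m _ (divX_mem_degreeLT hp)
  set t := (Fin.cons (d₁ - d₂) (r₁ - r₂) : Fin (m + 1) → F) ⬝ᵥ
      aevalMulVec (blk d₁ r₁ c A) (firstVec F m) p.divX with ht
  have hz : aevalMulVec (blk d₂ r₂ c A) (firstVec F m) (X * R + C t) = 0 := by
    rw [map_add, aevalMulVec_X_mul, aevalMulVec_C, ← hRe, mulVec_sub]
    rw [aevalMulVec_X_mul_divX, aevalMulVec_X_mul_divX (blk d₂ r₂ c A),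
      blk_mulVec_sub d₁ d₂ r₁ r₂, ← ht] at h
    rw [sub_add_eq_add_sub, sub_eq_zero]
    exact add_right_cancel h
  have hdvd := (isCyclicVec_iff_charpoly_dvd _ _).1
    ((isCyclicVec_blk_iff d₂ r₂ c A).2 hc) _ hz
  have h0 : X * R + C t = 0 := by
    refine eq_zero_of_dvd_of_degree_lt hdvd ?_
    rw [charpoly_degree_eq_dim, Fintype.card_fin]
    exact mem_degreeLT.1 (X_mul_add_C_mem_degreeLT hR t)
  have hR0 : R = 0 := by
    ext i
    have := congrArg (fun p => coeff p (i + 1)) h0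
    simpa [coeff_X_mul, coeff_C_succ] using this
  have ht0 : t = 0 := by
    have := congrArg (fun p => coeff p 0) h0
    simpa using this
  refine ⟨?_, ht0⟩
  rw [hR0, map_zero] at hRe
  exact sub_eq_zero.1 hRe

theorem blk_eq_of_charpoly_eq {d₁ d₂ : F} {r₁ r₂ c : Fin m → F} {A : Matrix (Fin m) (Fin m) F}
    (hc : IsCyclicVec A c) (h : (blk d₁ r₁ c A).charpoly = (blk d₂ r₂ c A).charpoly) :
    d₁ = d₂ ∧ r₁ = r₂ := by
  set f := (blk d₁ r₁ c A).charpoly with hf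
  have hdeg : f.natDegree = m + 1 := by
    rw [hf, charpoly_natDegree_eq_dim, Fintype.card_fin]
  have hmonic : f.Monic := charpoly_monic _
  have hcoeff : ∀ j i, (divX^[j] f).coeff i = f.coeff (i + j) := by
    intro j
    induction j with
    | zero => intro i; rfl
    | succ j ih =>
      intro i
      rw [Function.iterate_succ_apply', coeff_divX, ih]
      congr 1; omega
  have hmem : ∀ j, divX^[j] f ∈ degreeLT F (m + 2) := by
    intro j
    rw [mem_degreeLT_iff_coeff]
    intro i hi
    rw [hcoeff]
    exact coeff_eq_zero_of_natDegree_lt (by omega)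
  have heq : ∀ j, aevalMulVec (blk d₁ r₁ c A) (firstVec F m) (divX^[j] f) =
      aevalMulVec (blk d₂ r₂ c A) (firstVec F m) (divX^[j] f) := by
    intro j
    induction j with
    | zero =>
      have e1 : aeval (blk d₁ r₁ c A) f = 0 := aeval_self_charpoly _
      have e2 : aeval (blk d₂ r₂ c A) f = 0 := by rw [h]; exact aeval_self_charpoly _
      rw [Function.iterate_zero_apply, aevalMulVec_apply, aevalMulVec_apply, e1, e2]
    | succ j ih =>
      rw [Function.iterate_succ_apply']
      exact (aevalMulVec_divX_eq hc (hmem j) ih).1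
  have hK : ∀ j, (Fin.cons (d₁ - d₂) (r₁ - r₂) : Fin (m + 1) → F) ⬝ᵥ
      aevalMulVec (blk d₁ r₁ c A) (firstVec F m) (divX^[j + 1] f) = 0 := by
    intro j
    rw [Function.iterate_succ_apply']
    exact (aevalMulVec_divX_eq hc (hmem j) (heq j)).2
  have hspan : ∀ k, k ≤ m + 1 → ∀ p ∈ degreeLT F k,
      (Fin.cons (d₁ - d₂) (r₁ - r₂) : Fin (m + 1) → F) ⬝ᵥ
        aevalMulVec (blk d₁ r₁ c A) (firstVec F m) p = 0 := by
    intro k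
    induction k with
    | zero =>
      intro _ p hp
      have : p = 0 := by
        ext i
        exact mem_degreeLT_iff_coeff.1 hp i (Nat.zero_le i)
      simp [this]
    | succ k ih =>
      intro hk p hp
      have hj : (m - k) + 1 + k = m + 1 := by omega
      have h1 := ih (by omega) (p - C (p.coeff k) * divX^[(m - k) + 1] f) (by
        rw [mem_degreeLT_iff_coeff] at hp ⊢
        intro i hi
        rw [coeff_sub, coeff_C_mul, hcoeff]
        rcases hi.eq_or_lt with rfl | hi
        · rw [show k + (m - k + 1) = f.natDegree by omega, hmonic.coeff_natDegree]
          ring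
        · have h2 : f.coeff (i + (m - k + 1)) = 0 :=
            coeff_eq_zero_of_natDegree_lt (by omega)
          rw [hp i hi, h2]
          ring)
      rw [map_sub, dotProduct_sub, ← smul_eq_C_mul, map_smul, dotProduct_smul, hK, smul_zero,
        sub_zero] at h1
      exact h1
  have hzero : (Fin.cons (d₁ - d₂) (r₁ - r₂) : Fin (m + 1) → F) = 0 := by
    rw [← dotProduct_eq_zero_iff]
    intro w
    obtain ⟨p, rfl⟩ := (isCyclicVec_iff_surjective _ _).1 ((isCyclicVec_blk_iff d₁ r₁ c A).2 hc) w
    rw [← aevalMulVec_modByMonic]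
    refine hspan (m + 1) le_rfl _ ?_
    have := degree_modByMonic_charpoly (blk d₁ r₁ c A) p
    rwa [Fintype.card_fin] at this
  constructor
  · exact sub_eq_zero.1 (congrFun hzero 0)
  · ext i
    exact sub_eq_zero.1 (congrFun hzero i.succ)

theorem exists_charpoly_blk_eq [Finite F] {c : Fin m → F} {A : Matrix (Fin m) (Fin m) F}
    (hc : IsCyclicVec A c) {f : F[X]} (hf : f.Monic) (hdeg : f.natDegree = m + 1) :
    ∃ d r, (blk d r c A).charpoly = f := by
  have key : ∀ p q : F[X], p.Monic → q.Monic → p.natDegree = m + 1 → q.natDegree = m + 1 →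
      (∀ i : Fin (m + 1), p.coeff i = q.coeff i) → p = q := by
    intro p q hp hq hpd hqd h
    ext i
    rcases lt_trichotomy i (m + 1) with hi | rfl | hi
    · exact h ⟨i, hi⟩
    · rw [← hpd, hp.coeff_natDegree, hpd, ← hqd, hq.coeff_natDegree]
    · rw [coeff_eq_zero_of_natDegree_lt (by omega), coeff_eq_zero_of_natDegree_lt (by omega)]
  let Φ : (Fin (m + 1) → F) → (Fin (m + 1) → F) :=
    fun v i => (blk (v 0) (Fin.tail v) c A).charpoly.coeff i
  have hnat : ∀ d r, (blk d r c A).charpoly.natDegree = m + 1 := fun d r => by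
    rw [charpoly_natDegree_eq_dim, Fintype.card_fin]
  have hinj : Function.Injective Φ := by
    intro v w h
    obtain ⟨h0, h1⟩ := blk_eq_of_charpoly_eq hc (key _ _ (charpoly_monic _) (charpoly_monic _)
      (hnat _ _) (hnat _ _) fun i => congrFun h i)
    rw [← Fin.cons_self_tail v, ← Fin.cons_self_tail w, h0, h1]
  obtain ⟨v, hv⟩ := (Finite.injective_iff_surjective.1 hinj) fun i => f.coeff i
  exact ⟨v 0, Fin.tail v, key _ _ (charpoly_monic _) hf (hnat _ _) hdeg fun i => congrFun hv i⟩

end Block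

theorem ncard_le_card_mul_of_fiber_le {α β : Type} [Finite α] [Finite β] (S : Set (α × β))
    (B : ℕ) (h : ∀ a, {b | (a, b) ∈ S}.ncard ≤ B) : S.ncard ≤ Nat.card α * B := by
  classical
  have := Fintype.ofFinite α
  let e : S ≃ Σ a : α, {b | (a, b) ∈ S} :=
    { toFun := fun x => ⟨x.1.1, x.1.2, x.2⟩
      invFun := fun x => ⟨(x.1, x.2.1), x.2.2⟩
      left_inv := fun _ => rfl
      right_inv := fun _ => rfl }
  rw [← Nat.card_coe_set_eq, Nat.card_congr e, Nat.card_sigma, Nat.card_eq_fintype_card]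
  calc ∑ a, Nat.card {b | (a, b) ∈ S} ≤ ∑ _a : α, B :=
        Finset.sum_le_sum fun a _ => by rw [Nat.card_coe_set_eq]; exact h a
    _ = _ := by simp

/-- Parameters for products of `m` elementary rank-one factors written in the basis of their
column vectors. -/
def Par (F : Type) : ℕ → Type
  | 0 => Unit
  | m + 1 => Par F m × (Fin m → F) × (Fin m → F)

instance Par.finite (F : Type) [Finite F] : ∀ m, Finite (Par F m)
  | 0 => inferInstanceAs (Finite Unit)
  | m + 1 =>
    have := Par.finite F m
    inferInstanceAs (Finite (Par F m × (Fin m → F) × (Fin m → F)))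

instance Par.nonempty (F : Type) [Zero F] : ∀ m, Nonempty (Par F m)
  | 0 => ⟨()⟩
  | m + 1 =>
    have ⟨P⟩ := Par.nonempty F m
    ⟨(P, 0, 0)⟩

/-- The matrix attached to a parameter. -/
def parMat {F : Type} [Field F] : ∀ m, Par F m → Matrix (Fin m) (Fin m) F
  | 0, _ => 1
  | m + 1, (P, c, ρ) => blk (1 + ρ ⬝ᵥ c) (ρ ᵥ* parMat m P) c (parMat m P)

section Par

variable {F : Type} [Field F]

theorem parMat_succ {m : ℕ} (P : Par F m) (c ρ : Fin m → F) :
    parMat (m + 1) (P, c, ρ) = blk (1 + ρ ⬝ᵥ c) (ρ ᵥ* parMat m P) c (parMat m P) := rfl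

theorem blk_eq_mul {m : ℕ} (d : F) (ρ c : Fin m → F) (A : Matrix (Fin m) (Fin m) F) :
    blk (d + ρ ⬝ᵥ c) (ρ ᵥ* A) c A = blk 1 ρ 0 1 * blk d 0 c A := by
  rw [blk_mul_blk, blk_inj]
  refine ⟨by simp, by simp, by simp, ?_⟩
  ext i j
  simp

theorem det_blk_add {m : ℕ} (d : F) (ρ c : Fin m → F) (A : Matrix (Fin m) (Fin m) F) :
    (blk (d + ρ ⬝ᵥ c) (ρ ᵥ* A) c A).det = d * A.det := by
  rw [blk_eq_mul, det_mul, det_blk_col_zero, det_blk_row_zero]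
  simp

theorem det_parMat : ∀ (m : ℕ) (P : Par F m), (parMat m P).det = 1
  | 0, _ => by simp [parMat]
  | m + 1, (P, c, ρ) => by rw [parMat_succ, det_blk_add, det_parMat m P, one_mul]

theorem vecMul_parMat_injective {m : ℕ} (P : Par F m) :
    Function.Injective fun ρ => ρ ᵥ* parMat m P :=
  vecMul_injective_iff_isUnit.2
    ((Matrix.isUnit_iff_isUnit_det _).2 (by rw [det_parMat]; exact isUnit_one))

theorem parMat_injective : ∀ m, Function.Injective (parMat (F := F) m)
  | 0 => fun _ _ _ => rfl
  | m + 1 => by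
    rintro ⟨P, c, ρ⟩ ⟨P', c', ρ'⟩ h
    rw [parMat_succ, parMat_succ, blk_inj] at h
    obtain ⟨-, h2, rfl, h4⟩ := h
    obtain rfl := parMat_injective m h4
    rw [vecMul_parMat_injective P h2]

theorem isCyclicVec_parMat_succ {m : ℕ} (P : Par F m) (c ρ : Fin m → F) :
    IsCyclicVec (parMat (m + 1) (P, c, ρ)) (firstVec F m) ↔ IsCyclicVec (parMat m P) c :=
  isCyclicVec_blk_iff _ _ _ _

/-- The parameters whose matrix has characteristic polynomial `f` and the first basis vector
as a cyclic vector. -/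
def cyclicParWith (F : Type) [Field F] (m : ℕ) (f : F[X]) : Set (Par F (m + 1)) :=
  {P | (parMat (m + 1) P).charpoly = f ∧ IsCyclicVec (parMat (m + 1) P) (firstVec F m)}

theorem eq_of_mem_cyclicParWith {m : ℕ} {f : F[X]} {P : Par F m} {c ρ ρ' : Fin m → F}
    (h : ((P, c, ρ) : Par F (m + 1)) ∈ cyclicParWith F m f)
    (h' : ((P, c, ρ') : Par F (m + 1)) ∈ cyclicParWith F m f) : ρ = ρ' :=
  vecMul_parMat_injective P (blk_eq_of_charpoly_eq ((isCyclicVec_parMat_succ _ _ _).1 h.2)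
    (h.1.trans h'.1.symm)).2

theorem card_fin_fun {F : Type} [Fintype F] (m : ℕ) :
    Nat.card (Fin m → F) = Fintype.card F ^ m := by
  simp [Nat.card_eq_fintype_card]

theorem card_par {F : Type} [Fintype F] : ∀ m, Nat.card (Par F m) = Fintype.card F ^ (m * (m - 1))
  | 0 => by
    have : Nat.card (Par F 0) = Nat.card Unit := rfl
    simp [this]
  | m + 1 => by
    have : Nat.card (Par F (m + 1)) = Nat.card (Par F m × (Fin m → F) × (Fin m → F)) := rfl
    rw [this, Nat.card_prod, Nat.card_prod, card_par m, card_fin_fun, ← pow_add, ← pow_add]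
    congr 1
    cases m with
    | zero => rfl
    | succ k => simp only [Nat.add_sub_cancel]; ring

variable [Fintype F]

/-- The pairs of a parameter and a vector that is not cyclic for its matrix. -/
def nonCyclicPairs (F : Type) [Field F] (m : ℕ) : Set (Par F m × (Fin m → F)) :=
  {x | ¬ IsCyclicVec (parMat m x.1) x.2}

/-- The parameters for which the first basis vector is not cyclic. -/
def nonCyclicPar (F : Type) [Field F] (m : ℕ) : Set (Par F (m + 1)) :=
  {P | ¬ IsCyclicVec (parMat (m + 1) P) (firstVec F m)}

theorem ncard_nonCyclicPar (m : ℕ) :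
    (nonCyclicPar F m).ncard = (nonCyclicPairs F m).ncard * Fintype.card F ^ m := by
  let e : Par F (m + 1) ≃ (Par F m × (Fin m → F)) × (Fin m → F) :=
    (Equiv.prodAssoc _ _ _).symm
  have h : nonCyclicPar F m = e ⁻¹' (nonCyclicPairs F m ×ˢ Set.univ) := by
    ext ⟨P, c, ρ⟩
    exact ⟨fun h => ⟨fun h' => h ((isCyclicVec_parMat_succ P c ρ).2 h'), trivial⟩,
      fun h h' => h.1 ((isCyclicVec_parMat_succ P c ρ).1 h')⟩
  rw [h, ← e.image_symm_eq_preimage, Set.ncard_image_of_injective _ e.symm.injective,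
    Set.ncard_prod, Set.ncard_univ, card_fin_fun]

theorem ncard_not_isCyclicVec_le_of_isCyclicVec {m : ℕ} {A : Matrix (Fin m) (Fin m) F}
    {v : Fin m → F} (h : IsCyclicVec A v) :
    {w | ¬ IsCyclicVec A w}.ncard ≤ m * Fintype.card F ^ (m - 1) := by
  have := ncard_not_isCyclicVec_le_of_dvd A h.charpoly_dvd
  rwa [Fintype.card_fin] at this

theorem ncard_nonCyclicPairs_succ_le (m : ℕ) :
    (nonCyclicPairs F (m + 1)).ncard ≤
      (nonCyclicPar F m).ncard * Fintype.card F ^ (m + 1) +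
        Nat.card (Par F (m + 1)) * ((m + 1) * Fintype.card F ^ m) := by
  have hsub : nonCyclicPairs F (m + 1) ⊆ (nonCyclicPar F m ×ˢ Set.univ) ∪
      {x | x ∈ nonCyclicPairs F (m + 1) ∧ x.1 ∉ nonCyclicPar F m} := by
    intro x hx
    by_cases h : x.1 ∈ nonCyclicPar F m
    · exact Or.inl ⟨h, trivial⟩
    · exact Or.inr ⟨hx, h⟩
  refine (Set.ncard_le_ncard hsub (Set.toFinite _)).trans ((Set.ncard_union_le _ _).trans
    (add_le_add ?_ ?_))
  · rw [Set.ncard_prod, Set.ncard_univ, card_fin_fun]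
  · refine ncard_le_card_mul_of_fiber_le _ _ fun P => ?_
    by_cases h : P ∈ nonCyclicPar F m
    · simp [h]
    · refine (Set.ncard_le_ncard (fun w hw => hw.1) (Set.toFinite _)).trans
        (ncard_not_isCyclicVec_le_of_isCyclicVec (not_not.1 h))

theorem card_mul_ncard_nonCyclicPairs_le (m : ℕ) :
    Fintype.card F * (nonCyclicPairs F m).ncard ≤ m ^ 2 * Fintype.card F ^ (m ^ 2) := by
  induction m with
  | zero =>
    have : nonCyclicPairs F 0 = ∅ := by
      ext x
      simp only [nonCyclicPairs, Set.mem_ofPred_eq, Set.mem_empty_iff_false, iff_false, not_not]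
      intro W _ _
      exact Subsingleton.elim _ _
    simp [this]
  | succ m ih =>
    have h := ncard_nonCyclicPairs_succ_le (F := F) m
    rw [ncard_nonCyclicPar, card_par, Nat.add_sub_cancel] at h
    set q := Fintype.card F
    set N := (nonCyclicPairs F m).ncard
    calc q * (nonCyclicPairs F (m + 1)).ncard
        ≤ q * (N * q ^ m * q ^ (m + 1) + q ^ ((m + 1) * m) * ((m + 1) * q ^ m)) :=
          Nat.mul_le_mul_left _ h
      _ = (q * N) * q ^ (2 * m + 1) + (m + 1) * q ^ ((m + 1) ^ 2) := by ring
      _ ≤ (m ^ 2 * q ^ (m ^ 2)) * q ^ (2 * m + 1) + (m + 1) * q ^ ((m + 1) ^ 2) :=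
          Nat.add_le_add_right (Nat.mul_le_mul_right _ ih) _
      _ = (m ^ 2 + m + 1) * q ^ ((m + 1) ^ 2) := by ring
      _ ≤ (m + 1) ^ 2 * q ^ ((m + 1) ^ 2) := Nat.mul_le_mul_right _ (by nlinarith)

theorem exists_mem_cyclicParWith {m : ℕ} {f : F[X]} (hf : f.Monic) (hdeg : f.natDegree = m + 1)
    (hf0 : f.coeff 0 = (-1) ^ (m + 1)) {P : Par F m} {c : Fin m → F}
    (hc : IsCyclicVec (parMat m P) c) :
    ∃ ρ, ((P, c, ρ) : Par F (m + 1)) ∈ cyclicParWith F m f := by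
  obtain ⟨d, r, h⟩ := exists_charpoly_blk_eq hc hf hdeg
  have hu : IsUnit (parMat m P) :=
    (Matrix.isUnit_iff_isUnit_det _).2 (by rw [det_parMat]; exact isUnit_one)
  obtain ⟨ρ, rfl⟩ := vecMul_surjective_iff_isUnit.2 hu r
  have hdet : (blk d (ρ ᵥ* parMat m P) c (parMat m P)).det = 1 := by
    rw [det_eq_sign_charpoly_coeff, h, hf0, Fintype.card_fin, ← mul_pow]
    simp
  have hd : d = 1 + ρ ⬝ᵥ c := by
    rw [← sub_add_cancel d (ρ ⬝ᵥ c), det_blk_add, det_parMat, mul_one] at hdet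
    rw [← hdet, sub_add_cancel]
  refine ⟨ρ, ?_, (isCyclicVec_parMat_succ _ _ _).2 hc⟩
  rw [parMat_succ, ← hd, h]

theorem ncard_cyclicParWith {m : ℕ} {f : F[X]} (hf : f.Monic) (hdeg : f.natDegree = m + 1)
    (hf0 : f.coeff 0 = (-1) ^ (m + 1)) :
    (cyclicParWith F m f).ncard + (nonCyclicPairs F m).ncard = Fintype.card F ^ (m ^ 2) := by
  have h1 : (cyclicParWith F m f).ncard = (nonCyclicPairs F m)ᶜ.ncard := by
    refine Set.ncard_congr (fun P _ => (P.1, P.2.1)) ?_ ?_ ?_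
    · rintro ⟨P, c, ρ⟩ h
      simp only [nonCyclicPairs, Set.mem_compl_iff, Set.mem_ofPred_eq, not_not]
      exact (isCyclicVec_parMat_succ _ _ _).1 h.2
    · rintro ⟨P, c, ρ⟩ ⟨P', c', ρ'⟩ h h' he
      simp only [Prod.mk.injEq] at he
      obtain ⟨rfl, rfl⟩ := he
      rw [eq_of_mem_cyclicParWith h h']
    · rintro ⟨P, c⟩ h
      simp only [nonCyclicPairs, Set.mem_compl_iff, Set.mem_ofPred_eq, not_not] at h
      obtain ⟨ρ, hρ⟩ := exists_mem_cyclicParWith hf hdeg hf0 h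
      exact ⟨(P, c, ρ), hρ, rfl⟩
  rw [h1, add_comm, Set.ncard_add_ncard_compl, Nat.card_prod, card_par, card_fin_fun, ← pow_add]
  congr 1
  cases m with
  | zero => rfl
  | succ k => simp only [Nat.add_sub_cancel]; ring

end Par

section SecondVector

variable {F : Type} [Field F]

theorem exists_aevalMulVec_consZero_ne_zero {m : ℕ} {d : F} {r c : Fin m → F}
    {A : Matrix (Fin m) (Fin m) F} (hc : IsCyclicVec A c) (hr : r ≠ 0) {p : F[X]}
    (hp : ¬ (blk d r c A).charpoly ∣ p) :
    ∃ w, aevalMulVec (blk d r c A) (Fin.cons 0 w) p ≠ 0 := by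
  by_contra! h
  apply hr
  rw [← dotProduct_eq_zero_iff]
  intro w
  have h1 : aevalMulVec (blk d r c A) (blk d r c A *ᵥ Fin.cons 0 w) p = 0 := by
    have h2 := aevalMulVec_X_mul (blk d r c A) (Fin.cons 0 w) p
    rw [h w, mulVec_zero, mul_comm, aevalMulVec_mul, aevalMulVec_apply _ _ X, aeval_X] at h2
    exact h2
  rw [blk_mulVec_cons, cons_eq_smul_firstVec_add, aevalMulVec_apply, mulVec_add,
    ← aevalMulVec_apply _ (Fin.cons 0 _), h, add_zero, mulVec_smul, smul_eq_zero, mul_zero,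
    zero_add] at h1
  refine h1.resolve_right fun h3 => hp ?_
  exact (isCyclicVec_iff_charpoly_dvd _ _).1 ((isCyclicVec_blk_iff d r c A).2 hc) _ h3

theorem ncard_not_isCyclicVec_cons_zero_le [Fintype F] {m : ℕ} {d : F} {r c : Fin m → F}
    {A : Matrix (Fin m) (Fin m) F} (hc : IsCyclicVec A c) (hr : r ≠ 0) :
    {w : Fin m → F | ¬ IsCyclicVec (blk d r c A) (Fin.cons 0 w)}.ncard ≤
      (m + 1) * Fintype.card F ^ (m - 1) := by
  have := ncard_not_isCyclicVec_le (blk d r c A) (consZero F m) fun p hp =>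
    exists_aevalMulVec_consZero_ne_zero hc hr (not_charpoly_dvd_div _ hp)
  simpa using this

theorem ne_zero_of_eval_one_charpoly_parMat {m : ℕ} {P : Par F m} {c ρ : Fin m → F}
    (h : (parMat (m + 1) (P, c, ρ)).charpoly.eval 1 ≠ 0) : ρ ᵥ* parMat m P ≠ 0 := by
  intro h0
  obtain rfl : ρ = 0 := vecMul_parMat_injective P (by simpa using h0)
  apply h
  rw [eval_charpoly, parMat_succ, det_eq_zero_of_row_eq_zero 0]
  intro j
  refine Fin.cases ?_ (fun j => ?_) j <;> simp [(Fin.succ_ne_zero _).symm]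

/-- Parameters in `cyclicParWith` whose matrix does not have the second basis vector as a
cyclic vector. -/
def secondNonCyclic (F : Type) [Field F] (k : ℕ) (f : F[X]) : Set (Par F (k + 2)) :=
  {P | P ∈ cyclicParWith F (k + 1) f ∧
    ¬ IsCyclicVec (parMat (k + 2) P) (Fin.cons 0 (firstVec F k))}

theorem exists_intertwiner_of_mem_cyclicParWith {m : ℕ} {f : F[X]} {P : Par F m}
    {c ρ c' ρ' : Fin m → F}
    (h : ((P, c, ρ) : Par F (m + 1)) ∈ cyclicParWith F m f)
    (h' : ((P, c', ρ') : Par F (m + 1)) ∈ cyclicParWith F m f) :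
    ∃ U : Matrix (Fin m) (Fin m) F, U.det ≠ 0 ∧ U *ᵥ c = c' ∧
      U * parMat m P = parMat m P * U ∧
      blk 1 0 0 U * parMat (m + 1) (P, c, ρ) = parMat (m + 1) (P, c', ρ') * blk 1 0 0 U := by
  have hc := (isCyclicVec_parMat_succ _ _ _).1 h.2
  have hc' := (isCyclicVec_parMat_succ _ _ _).1 h'.2
  obtain ⟨U, hdet, hU, hUc⟩ := exists_intertwiner hc hc' rfl
  refine ⟨U, hdet, hU, hUc, ?_⟩
  have hu : IsUnit U := (Matrix.isUnit_iff_isUnit_det _).2 (isUnit_iff_ne_zero.2 hdet)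
  obtain ⟨r, hr⟩ := vecMul_surjective_iff_isUnit.2 hu (ρ ᵥ* parMat m P)
  replace hr : r ᵥ* U = ρ ᵥ* parMat m P := hr
  have hW : blk 1 0 0 U * parMat (m + 1) (P, c, ρ) =
      blk (1 + ρ ⬝ᵥ c) r c' (parMat m P) * blk 1 0 0 U := by
    rw [parMat_succ, blk_mul_blk, blk_mul_blk, blk_inj]
    refine ⟨by simp, by simp [hr], by simp [hU], ?_⟩
    rw [hUc]
    ext i j
    simp
  have hWu : IsUnit (blk 1 0 0 U) :=
    (Matrix.isUnit_iff_isUnit_det _).2 (isUnit_iff_ne_zero.2 (by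
      rw [det_blk_row_zero, one_mul]; exact hdet))
  have hch : (blk (1 + ρ ⬝ᵥ c) r c' (parMat m P)).charpoly =
      (parMat (m + 1) (P, c, ρ)).charpoly := by
    obtain ⟨W, hW'⟩ := hWu
    rw [← hW'] at hW
    have : blk (1 + ρ ⬝ᵥ c) r c' (parMat m P) = W.val * parMat (m + 1) (P, c, ρ) * W⁻¹.val := by
      rw [hW, Matrix.mul_assoc, Units.mul_inv, Matrix.mul_one]
    rw [this, Matrix.coe_units_inv]
    exact Matrix.charpoly_units_conj W _
  obtain ⟨h1, h2⟩ := blk_eq_of_charpoly_eq hc' (hch.trans (h.1.trans h'.1.symm))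
  rw [hW, parMat_succ, h1, h2]

variable [Fintype F]

theorem ncard_secondNonCyclic_fiber_le {k : ℕ} {f : F[X]} (hf1 : f.eval 1 ≠ 0)
    {P : Par F (k + 1)} (hP : IsCyclicVec (parMat (k + 1) P) (firstVec F k)) :
    {x : (Fin (k + 1) → F) × (Fin (k + 1) → F) |
      ((P, x) : Par F (k + 2)) ∈ secondNonCyclic F k f}.ncard ≤
      (k + 2) * Fintype.card F ^ k := by
  classical
  rcases Set.eq_empty_or_nonempty {x : (Fin (k + 1) → F) × (Fin (k + 1) → F) |
      ((P, x) : Par F (k + 2)) ∈ secondNonCyclic F k f} with hT | ⟨⟨c₀, ρ₀⟩, h₀⟩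
  · rw [hT]; simp
  have hc₀ := (isCyclicVec_parMat_succ _ _ _).1 h₀.1.2
  have key : ∀ x : (Fin (k + 1) → F) × (Fin (k + 1) → F),
      ((P, x) : Par F (k + 2)) ∈ secondNonCyclic F k f →
      ∃ w, ¬ IsCyclicVec (parMat (k + 2) (P, c₀, ρ₀)) (Fin.cons 0 w) ∧
        ∃ U : Matrix (Fin (k + 1)) (Fin (k + 1)) F, U.det ≠ 0 ∧ U *ᵥ c₀ = x.1 ∧
          U * parMat (k + 1) P = parMat (k + 1) P * U ∧ U *ᵥ w = firstVec F k := by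
    rintro ⟨c, ρ⟩ h
    obtain ⟨U, hdet, hU, hUc, hW⟩ := exists_intertwiner_of_mem_cyclicParWith h₀.1 h.1
    have hu : IsUnit U := (Matrix.isUnit_iff_isUnit_det _).2 (isUnit_iff_ne_zero.2 hdet)
    obtain ⟨w, hw⟩ := mulVec_surjective_iff_isUnit.2 hu (firstVec F k)
    refine ⟨w, fun hcyc => h.2 ?_, U, hdet, hU, hUc, hw⟩
    rw [← isCyclicVec_intertwiner (by rwa [det_blk_row_zero, one_mul]) hW, blk_mulVec_cons,
      hw] at hcyc
    simpa using hcyc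
  choose! w hw U hdet hU hUc hUw using key
  refine le_trans ?_ (ncard_not_isCyclicVec_cons_zero_le (d := 1 + ρ₀ ⬝ᵥ c₀) hc₀
    (ne_zero_of_eval_one_charpoly_parMat (by rw [h₀.1.1]; exact hf1)))
  refine Set.ncard_le_ncard_of_injOn w (fun x hx => hw x hx) ?_ (Set.toFinite _)
  rintro ⟨c, ρ⟩ h ⟨c', ρ'⟩ h' he
  have hwc : IsCyclicVec (parMat (k + 1) P) (w (c, ρ)) := by
    rw [← isCyclicVec_intertwiner (hdet _ h) (hUc _ h), hUw _ h]
    exact hP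
  have hUU : U (c, ρ) = U (c', ρ') :=
    intertwiner_ext hwc (hUc _ h) (hUc _ h') (by rw [hUw _ h, he, hUw _ h'])
  have hcc : c = c' := by
    have h1 := hU _ h
    have h2 := hU _ h'
    rw [hUU] at h1
    exact h1.symm.trans h2
  subst hcc
  rw [eq_of_mem_cyclicParWith h.1 h'.1]

theorem card_mul_ncard_secondNonCyclic_le {k : ℕ} {f : F[X]} (hf1 : f.eval 1 ≠ 0) :
    Fintype.card F * (secondNonCyclic F k f).ncard ≤
      (k ^ 2 + k + 2) * Fintype.card F ^ ((k + 1) ^ 2) := by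
  let S₀ : Set (Par F (k + 1) × ((Fin (k + 1) → F) × (Fin (k + 1) → F))) :=
    {x | ((x.1, x.2) : Par F (k + 2)) ∈ secondNonCyclic F k f}
  let S₁ : Set (Par F (k + 1) × ((Fin (k + 1) → F) × (Fin (k + 1) → F))) :=
    {x | x ∈ S₀ ∧ x.1 ∈ nonCyclicPar F k}
  let S₂ : Set (Par F (k + 1) × ((Fin (k + 1) → F) × (Fin (k + 1) → F))) :=
    {x | x ∈ S₀ ∧ x.1 ∉ nonCyclicPar F k}
  have h0 : (secondNonCyclic F k f).ncard = S₀.ncard := rfl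
  have hsub : S₀ ⊆ S₁ ∪ S₂ := by
    intro x hx
    by_cases h : x.1 ∈ nonCyclicPar F k
    · exact Or.inl ⟨hx, h⟩
    · exact Or.inr ⟨hx, h⟩
  have h1 : S₁.ncard ≤ (nonCyclicPairs F k).ncard * Fintype.card F ^ k *
      Fintype.card F ^ (k + 1) := by
    rw [← ncard_nonCyclicPar, ← card_fin_fun, ← Set.ncard_univ, ← Set.ncard_prod]
    refine Set.ncard_le_ncard_of_injOn (fun x => (x.1, x.2.1)) (fun x hx => ⟨hx.2, trivial⟩)
      ?_ (Set.toFinite _)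
    rintro ⟨P, c, ρ⟩ h ⟨P', c', ρ'⟩ h' he
    simp only [Prod.mk.injEq] at he
    obtain ⟨rfl, rfl⟩ := he
    rw [eq_of_mem_cyclicParWith h.1.1 h'.1.1]
  have h2 : S₂.ncard ≤ Nat.card (Par F (k + 1)) * ((k + 2) * Fintype.card F ^ k) := by
    refine ncard_le_card_mul_of_fiber_le _ _ fun P => ?_
    by_cases h : P ∈ nonCyclicPar F k
    · have : {b | (P, b) ∈ S₂} = ∅ := by
        ext b
        exact ⟨fun hb => hb.2 h, False.elim⟩
      rw [this]; simp
    · exact (Set.ncard_le_ncard (fun w hw => hw.1) (Set.toFinite _)).trans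
        (ncard_secondNonCyclic_fiber_le hf1 (not_not.1 h))
  rw [card_par, Nat.add_sub_cancel] at h2
  have h3 := card_mul_ncard_nonCyclicPairs_le (F := F) k
  have h4 := (Set.ncard_le_ncard hsub (Set.toFinite _)).trans (Set.ncard_union_le _ _)
  rw [h0]
  set q := Fintype.card F
  set N := (nonCyclicPairs F k).ncard
  calc q * S₀.ncard
      ≤ q * (N * q ^ k * q ^ (k + 1) + q ^ ((k + 1) * k) * ((k + 2) * q ^ k)) :=
        Nat.mul_le_mul_left _ (h4.trans (Nat.add_le_add h1 h2))
    _ = (q * N) * q ^ (2 * k + 1) + (k + 2) * q ^ ((k + 1) ^ 2) := by ring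
    _ ≤ (k ^ 2 * q ^ (k ^ 2)) * q ^ (2 * k + 1) + (k + 2) * q ^ ((k + 1) ^ 2) :=
        Nat.add_le_add_right (Nat.mul_le_mul_right _ h3) _
    _ = _ := by ring

end SecondVector

/-- The product of the elementary matrices `1 + uᵢ φᵢ`. -/
def factorProd {F : Type} [Field F] {ι : Type} [Fintype ι] [DecidableEq ι] {l : ℕ}
    (u φ : Fin l → ι → F) : Matrix ι ι F :=
  (List.ofFn fun i => 1 + vecMulVec (u i) (φ i)).prod

section FactorProd

variable {F : Type} [Field F] {ι : Type} [Fintype ι] [DecidableEq ι]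

theorem factorProd_succ {l : ℕ} (u φ : Fin (l + 1) → ι → F) :
    factorProd u φ = (1 + vecMulVec (u 0) (φ 0)) *
      factorProd (fun i : Fin l => u i.succ) fun i => φ i.succ := by
  rw [factorProd, List.ofFn_succ, List.prod_cons]; rfl

theorem factorProd_castSucc {l : ℕ} (u φ : Fin (l + 1) → ι → F) :
    factorProd u φ = (factorProd (fun i : Fin l => u i.castSucc) fun i => φ i.castSucc) *
      (1 + vecMulVec (u (Fin.last l)) (φ (Fin.last l))) := by
  rw [factorProd, List.ofFn_succ', List.concat_eq_append, List.prod_append, List.prod_singleton]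
  rfl

theorem vecMul_one_add_vecMulVec (w u φ : ι → F) :
    w ᵥ* (1 + vecMulVec u φ) = w + (w ⬝ᵥ u) • φ := by
  rw [vecMul_add, vecMul_one, vecMul_vecMulVec]

theorem vecMul_factorProd {l : ℕ} {u φ : Fin l → ι → F} {w : ι → F}
    (h : ∀ i, w ⬝ᵥ u i = 0) : w ᵥ* factorProd u φ = w := by
  induction l with
  | zero => simp [factorProd]
  | succ l ih =>
    rw [factorProd_succ, ← vecMul_vecMul, vecMul_one_add_vecMulVec, h, zero_smul, add_zero]
    exact ih fun i => h _

theorem one_add_vecMulVec_mul {u φ : ι → F} (h : φ ⬝ᵥ u = 0) :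
    (1 + vecMulVec u φ) * (1 - vecMulVec u φ) = 1 := by
  have : vecMulVec u φ * vecMulVec u φ = 0 := by
    rw [vecMulVec_mul_vecMulVec, h]; ext i j; simp [vecMulVec_apply]
  rw [Matrix.add_mul, Matrix.mul_sub, Matrix.one_mul, Matrix.mul_sub, this]
  simp

theorem mul_factorProd_mul {U V : Matrix ι ι F} (hVU : V * U = 1) {l : ℕ}
    (u φ : Fin l → ι → F) :
    U * factorProd u φ * V = factorProd (fun i => U *ᵥ u i) fun i => φ i ᵥ* V := by
  have hUV : U * V = 1 := mul_eq_one_comm.1 hVU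
  induction l with
  | zero => simp [factorProd, hUV]
  | succ l ih =>
    rw [factorProd_succ, factorProd_succ (fun i => U *ᵥ u i), ← ih, ← vecMulVec_mul,
      ← mul_vecMulVec]
    calc U * ((1 + vecMulVec (u 0) (φ 0)) *
          factorProd (fun i => u i.succ) fun i => φ i.succ) * V
        = U * (1 + vecMulVec (u 0) (φ 0)) * 1 *
          (factorProd (fun i => u i.succ) fun i => φ i.succ) * V := by
          simp only [Matrix.mul_assoc, Matrix.one_mul]
      _ = U * (1 + vecMulVec (u 0) (φ 0)) * (V * U) *
          (factorProd (fun i => u i.succ) fun i => φ i.succ) * V := by rw [hVU]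
      _ = (U * V + U * vecMulVec (u 0) (φ 0) * V) *
          (U * (factorProd (fun i => u i.succ) fun i => φ i.succ) * V) := by
          simp only [Matrix.mul_assoc, Matrix.mul_add, Matrix.add_mul, Matrix.one_mul]
      _ = _ := by rw [hUV, Matrix.mul_assoc U]

theorem factorProd_single_injective {l : ℕ} {a : Fin l → ι} (ha : Function.Injective a)
    {ν ν' : Fin l → ι → F} (h : ∀ i, ν i (a i) = 0)
    (he : factorProd (fun i => Pi.single (a i) 1) ν = factorProd (fun i => Pi.single (a i) 1) ν') :
    ν = ν' := by
  induction l with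
  | zero => exact Subsingleton.elim _ _
  | succ l ih =>
    rw [factorProd_castSucc, factorProd_castSucc _ ν'] at he
    have key : ∀ ν : Fin (l + 1) → ι → F, (Pi.single (a (Fin.last l)) 1 : ι → F) ᵥ*
        factorProd (fun i : Fin l => Pi.single (a i.castSucc) 1) (fun i => ν i.castSucc) =
        Pi.single (a (Fin.last l)) 1 := fun ν => by
      refine vecMul_factorProd fun i => ?_
      rw [single_one_dotProduct, Pi.single_eq_of_ne]
      intro h
      exact (Fin.castSucc_lt_last i).ne (ha h).symm
    have hlast : ν (Fin.last l) = ν' (Fin.last l) := by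
      have := congrArg (fun M => (Pi.single (a (Fin.last l)) 1 : ι → F) ᵥ* M) he
      simp only [← vecMul_vecMul] at this
      rw [key, key, vecMul_one_add_vecMulVec, vecMul_one_add_vecMulVec, single_one_dotProduct,
        Pi.single_eq_same, one_smul, one_smul] at this
      exact add_left_cancel this
    have hinit : (fun i : Fin l => ν i.castSucc) = fun i => ν' i.castSucc := by
      refine ih (ha.comp (Fin.castSucc_injective l)) (fun i => h _) ?_
      rw [← hlast] at he
      have := congrArg (fun M => M * (1 - vecMulVec (Pi.single (a (Fin.last l)) 1)
        (ν (Fin.last l)))) he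
      simp only [Matrix.mul_assoc] at this
      rw [one_add_vecMulVec_mul (by rw [dotProduct_single_one, h]), Matrix.mul_one,
        Matrix.mul_one] at this
      exact this
    ext1 i
    refine Fin.lastCases hlast (fun i => ?_) i
    exact congrFun hinit i

theorem exists_prod_ofFn_blk {m l : ℕ} (c : Fin l → Fin m → F)
    (A : Fin l → Matrix (Fin m) (Fin m) F) :
    ∃ c', (List.ofFn fun i => blk 1 0 (c i) (A i)).prod = blk 1 0 c' (List.ofFn A).prod := by
  induction l with
  | zero =>
    refine ⟨0, ?_⟩
    ext i j
    refine Fin.cases ?_ (fun i => ?_) i <;> refine Fin.cases ?_ (fun j => ?_) j <;>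
      simp [Matrix.one_apply, (Fin.succ_ne_zero _).symm]
  | succ l ih =>
    obtain ⟨c', h⟩ := ih (fun i => c i.succ) fun i => A i.succ
    refine ⟨c 0 + A 0 *ᵥ c', ?_⟩
    rw [List.ofFn_succ, List.prod_cons, h, blk_mul_blk, List.ofFn_succ, List.prod_cons, blk_inj]
    refine ⟨by simp, by simp, by simp, ?_⟩
    ext i j
    simp

theorem exists_parMat_eq_factorProd : ∀ (m : ℕ) (ν : Fin m → Fin m → F), (∀ i, ν i i = 0) →
    ∃ P, parMat m P = factorProd (fun i => Pi.single i 1) ν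
  | 0, _, _ => ⟨(), Subsingleton.elim _ _⟩
  | m + 1, ν, hν => by
    obtain ⟨P, hP⟩ := exists_parMat_eq_factorProd m (fun i j => ν i.succ j.succ) fun i => hν _
    obtain ⟨c, hc⟩ := exists_prod_ofFn_blk (fun i : Fin m => Pi.single i (ν i.succ 0))
      fun i => 1 + vecMulVec (Pi.single i 1) fun j => ν i.succ j.succ
    refine ⟨(P, c, fun j => ν 0 j.succ), ?_⟩
    have h0 : 1 + vecMulVec (Pi.single 0 1) (ν 0) =
        blk 1 (fun j => ν 0 j.succ) 0 (1 : Matrix (Fin m) (Fin m) F) := by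
      ext i j
      refine Fin.cases ?_ (fun i => ?_) i <;> refine Fin.cases ?_ (fun j => ?_) j <;>
        simp [Matrix.one_apply, (Fin.succ_ne_zero _).symm, vecMulVec_apply, hν]
    have h1 : ∀ i : Fin m, 1 + vecMulVec (Pi.single i.succ 1) (ν i.succ) =
        blk 1 0 (Pi.single i (ν i.succ 0))
          (1 + vecMulVec (Pi.single i 1) fun j => ν i.succ j.succ) := by
      intro i
      ext a b
      refine Fin.cases ?_ (fun a => ?_) a <;> refine Fin.cases ?_ (fun b => ?_) b <;>
        simp [Matrix.one_apply, (Fin.succ_ne_zero _).symm, vecMulVec_apply, Pi.single_apply]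
    rw [parMat_succ, blk_eq_mul, factorProd_succ, h0]
    congr 1
    rw [factorProd]
    simp only [h1]
    rw [hc, hP]
    rfl

theorem exists_factorProd_eq_parMat [Finite F] : ∀ (m : ℕ) (P : Par F m),
    ∃ ν : Fin m → Fin m → F, (∀ i, ν i i = 0) ∧
      parMat m P = factorProd (fun i => Pi.single i 1) ν
  | 0, _ => ⟨0, fun _ => rfl, Subsingleton.elim _ _⟩
  | m + 1, P => by
    have := Fintype.ofFinite F
    let off : (Fin (m + 1) → Fin m → F) → Fin (m + 1) → Fin (m + 1) → F :=
      fun ψ i => i.insertNth 0 (ψ i)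
    have hoff : ∀ ψ i, off ψ i i = 0 := fun ψ i => by simp [off]
    choose Ψ hΨ using fun ψ => exists_parMat_eq_factorProd (m + 1) (off ψ) (hoff ψ)
    have hinj : Function.Injective Ψ := by
      intro ψ ψ' h
      have h1 := factorProd_single_injective (a := id) Function.injective_id (hoff ψ)
        ((hΨ ψ).symm.trans ((congrArg _ h).trans (hΨ ψ')))
      ext i j
      have := congrFun (congrFun h1 i) (i.succAbove j)
      simpa [off] using this
    have hbij := (Nat.bijective_iff_injective_and_card Ψ).2 ⟨hinj, by
      rw [card_par, Nat.card_fun, card_fin_fun, ← pow_mul]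
      simp [mul_comm]⟩
    obtain ⟨ψ, rfl⟩ := hbij.2 P
    exact ⟨off ψ, hoff ψ, hΨ ψ⟩

theorem det_of_ne_zero_of_factorProd_eq {n : ℕ} {G : Matrix (Fin n) (Fin n) F}
    (hG : (G - 1).det ≠ 0) {u φ : Fin n → Fin n → F} (h : factorProd u φ = G) :
    (of u)ᵀ.det ≠ 0 := by
  intro h0
  obtain ⟨w, hw, hwu⟩ := exists_vecMul_eq_zero_iff.2 h0
  refine hG (exists_vecMul_eq_zero_iff.1 ⟨w, hw, ?_⟩)
  rw [vecMul_sub, vecMul_one, ← h, vecMul_factorProd, sub_self]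
  intro i
  exact congrFun hwu i

theorem transpose_of_mulVec_single {n : ℕ} (u : Fin n → Fin n → F) (i : Fin n) :
    (of u)ᵀ *ᵥ Pi.single i 1 = u i := by
  rw [mulVec_single_one]; rfl

theorem exists_factorProd_eq_iff [Finite F] {n : ℕ} {G : Matrix (Fin n) (Fin n) F}
    (hG : (G - 1).det ≠ 0) (u : Fin n → Fin n → F) :
    (∃ φ, (∀ i, φ i ⬝ᵥ u i = 0) ∧ factorProd u φ = G) ↔
      (of u)ᵀ.det ≠ 0 ∧ ∃ P, (of u)ᵀ * parMat n P = G * (of u)ᵀ := by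
  constructor
  · rintro ⟨φ, hφ, h⟩
    have hdet := det_of_ne_zero_of_factorProd_eq hG h
    refine ⟨hdet, ?_⟩
    have hVU := nonsing_inv_mul (of u)ᵀ (isUnit_iff_ne_zero.2 hdet)
    obtain ⟨P, hP⟩ := exists_parMat_eq_factorProd n (fun i => φ i ᵥ* (of u)ᵀ) fun i => hφ i
    refine ⟨P, ?_⟩
    have := mul_factorProd_mul hVU (fun i => Pi.single i 1) fun i => φ i ᵥ* (of u)ᵀ
    simp only [transpose_of_mulVec_single, vecMul_vecMul,
      mul_eq_one_comm.1 hVU, vecMul_one] at this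
    rw [hP, ← h, ← this, Matrix.mul_assoc _ _ (of u)ᵀ, hVU, Matrix.mul_one]
  · rintro ⟨hdet, P, hP⟩
    have hVU := nonsing_inv_mul (of u)ᵀ (isUnit_iff_ne_zero.2 hdet)
    obtain ⟨ν, hν, hX⟩ := exists_factorProd_eq_parMat n P
    refine ⟨fun i => ν i ᵥ* ((of u)ᵀ)⁻¹, fun i => ?_, ?_⟩
    · rw [← transpose_of_mulVec_single u i, dotProduct_mulVec, vecMul_vecMul, hVU, vecMul_one,
        dotProduct_single_one, hν]
    · have := mul_factorProd_mul hVU (fun i => Pi.single i 1) ν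
      simp only [transpose_of_mulVec_single] at this
      rw [← this, ← hX, hP, Matrix.mul_assoc, mul_eq_one_comm.1 hVU, Matrix.mul_one]

theorem factorProd_right_injective {n : ℕ} {G : Matrix (Fin n) (Fin n) F}
    (hG : (G - 1).det ≠ 0) {u φ φ' : Fin n → Fin n → F} (hφ : ∀ i, φ i ⬝ᵥ u i = 0)
    (h : factorProd u φ = G) (h' : factorProd u φ' = G) : φ = φ' := by
  have hdet := det_of_ne_zero_of_factorProd_eq hG h
  have hVU := nonsing_inv_mul (of u)ᵀ (isUnit_iff_ne_zero.2 hdet)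
  have hUV := mul_eq_one_comm.1 hVU
  have key : ∀ φ, factorProd u φ = G →
      factorProd (fun i => Pi.single i 1) (fun i => φ i ᵥ* (of u)ᵀ) =
        ((of u)ᵀ)⁻¹ * G * (of u)ᵀ := by
    intro φ h
    have := mul_factorProd_mul hUV u φ
    rw [h] at this
    rw [this]
    congr 1
    ext1 i
    rw [← transpose_of_mulVec_single u i, mulVec_mulVec, hVU, one_mulVec]
  have := factorProd_single_injective (a := id) Function.injective_id
    (fun i => hφ i) ((key φ h).trans (key φ' h').symm)
  ext1 i
  have h1 := congrArg (fun w => w ᵥ* ((of u)ᵀ)⁻¹) (congrFun this i)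
  simpa [vecMul_vecMul, hUV] using h1

theorem ne_zero_of_factorProd_eq {n : ℕ} {G : Matrix (Fin n) (Fin n) F}
    (hG : (G - 1).det ≠ 0) {u φ : Fin n → Fin n → F} (h : factorProd u φ = G) (i : Fin n) :
    u i ≠ 0 ∧ φ i ≠ 0 := by
  have key : ∀ u φ : Fin n → Fin n → F, factorProd u φ = G → u i ≠ 0 := by
    intro u φ h h0
    refine det_of_ne_zero_of_factorProd_eq hG h (det_eq_zero_of_column_eq_zero i fun j => ?_)
    exact congrFun h0 j
  refine ⟨key u φ h, fun h0 => ?_⟩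
  refine key (Function.update u i 0) φ ?_ (Function.update_self _ _ _)
  rw [← h, factorProd, factorProd]
  congr 2
  ext1 j
  by_cases hj : j = i
  · subst hj
    ext a b
    simp [h0]
  · rw [Function.update_of_ne hj]

end FactorProd

/-- The tuples of vectors that occur as the column vectors of a factorization of `G` into
elementary matrices `1 + uᵢ φᵢ` of determinant one. -/
def frames {F : Type} [Field F] {n : ℕ} (G : Matrix (Fin n) (Fin n) F) :
    Set (Fin n → Fin n → F) :=
  {u | ∃ φ, (∀ i, φ i ⬝ᵥ u i = 0) ∧ factorProd u φ = G}

section Frames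

variable {F : Type} [Field F]

theorem firstVec_eq_single (m : ℕ) : firstVec F m = Pi.single 0 1 := by
  ext i
  refine Fin.cases ?_ (fun i => ?_) i <;> simp

theorem consZero_firstVec_eq_single (k : ℕ) :
    (Fin.cons 0 (firstVec F k) : Fin (k + 2) → F) = Pi.single 1 1 := by
  rw [firstVec_eq_single]
  ext i
  refine Fin.cases ?_ (fun i => ?_) i
  · simp
  · rw [Fin.cons_succ, Pi.single_apply, Pi.single_apply, ← Fin.succ_zero_eq_one]
    simp only [Fin.succ_inj]

theorem charpoly_eq_of_mul_eq {n : ℕ} {A B U : Matrix (Fin n) (Fin n) F} (hU : U.det ≠ 0)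
    (h : U * A = B * U) : A.charpoly = B.charpoly := by
  obtain ⟨W, rfl⟩ := (Matrix.isUnit_iff_isUnit_det U).2 (isUnit_iff_ne_zero.2 hU)
  have : B = W.val * A * W⁻¹.val := by
    rw [h, Matrix.mul_assoc, Units.mul_inv, Matrix.mul_one]
  rw [this, Matrix.coe_units_inv]
  exact (Matrix.charpoly_units_conj W A).symm

theorem mem_frames_iff [Finite F] {n : ℕ} {G : Matrix (Fin n) (Fin n) F}
    (hG : (G - 1).det ≠ 0) (u : Fin n → Fin n → F) :
    u ∈ frames G ↔ (of u)ᵀ.det ≠ 0 ∧ ∃ P, (of u)ᵀ * parMat n P = G * (of u)ᵀ :=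
  exists_factorProd_eq_iff hG u

theorem isCyclicVec_apply_iff {n : ℕ} {A G : Matrix (Fin n) (Fin n) F} {u : Fin n → Fin n → F}
    (hu : (of u)ᵀ.det ≠ 0) (h : (of u)ᵀ * A = G * (of u)ᵀ) (i : Fin n) :
    IsCyclicVec G (u i) ↔ IsCyclicVec A (Pi.single i 1) := by
  rw [← isCyclicVec_intertwiner hu h, transpose_of_mulVec_single]

theorem of_transpose_injective {F : Type} {n : ℕ} {u v : Fin n → Fin n → F}
    (h : (of u)ᵀ = (of v)ᵀ) :
    u = v :=
  of.injective (transpose_injective h)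

theorem ncard_frames_cyclic [Finite F] {m : ℕ} {G : Matrix (Fin (m + 1)) (Fin (m + 1)) F}
    (hG : (G - 1).det ≠ 0) :
    {u ∈ frames G | IsCyclicVec G (u 0)}.ncard =
      {v | IsCyclicVec G v}.ncard * (cyclicParWith F m G.charpoly).ncard := by
  rw [← Set.ncard_prod]
  have key : ∀ x : (Fin (m + 1) → F) × Par F (m + 1),
      x ∈ {v | IsCyclicVec G v} ×ˢ cyclicParWith F m G.charpoly →
      ∃ u : Fin (m + 1) → Fin (m + 1) → F, (of u)ᵀ.det ≠ 0 ∧ u 0 = x.1 ∧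
        (of u)ᵀ * parMat (m + 1) x.2 = G * (of u)ᵀ := by
    rintro ⟨v, P⟩ ⟨hv, hP⟩
    obtain ⟨U, hU, hUv, hUP⟩ := exists_intertwiner hP.2 hv hP.1
    refine ⟨fun i j => U j i, hU, ?_, hUP⟩
    rw [firstVec_eq_single, mulVec_single_one] at hUv
    exact hUv
  choose! u hu hu0 huP using key
  symm
  refine Set.ncard_congr (fun x _ => u x) ?_ ?_ ?_
  · intro x hx
    refine ⟨(mem_frames_iff hG _).2 ⟨hu x hx, x.2, huP x hx⟩, ?_⟩
    rw [hu0 x hx]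
    exact hx.1
  · intro x y hx hy h
    refine Prod.ext ?_ (parMat_injective _ ?_)
    · rw [← hu0 x hx, ← hu0 y hy, h]
    · have h1 := huP x hx
      have h2 := huP y hy
      rw [h, ← h2] at h1
      have hW := (Matrix.isUnit_iff_isUnit_det _).2 (isUnit_iff_ne_zero.2 (hu y hy))
      exact hW.mul_left_cancel h1
  · rintro w ⟨hw, hw0⟩
    obtain ⟨hdet, P, hP⟩ := (mem_frames_iff hG _).1 hw
    have hcyc := (isCyclicVec_apply_iff hdet hP 0).1 hw0
    rw [← firstVec_eq_single] at hcyc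
    have hx : (w 0, P) ∈ {v | IsCyclicVec G v} ×ˢ cyclicParWith F m G.charpoly :=
      ⟨hw0, charpoly_eq_of_mul_eq hdet hP, hcyc⟩
    refine ⟨_, hx, of_transpose_injective (intertwiner_ext hcyc (huP _ hx) hP ?_)⟩
    rw [firstVec_eq_single, transpose_of_mulVec_single, transpose_of_mulVec_single, hu0 _ hx]

theorem ncard_frames_cyclic_not_cyclic_le [Fintype F] {k : ℕ}
    {G : Matrix (Fin (k + 2)) (Fin (k + 2)) F} (hG : (G - 1).det ≠ 0) :
    {u ∈ frames G | IsCyclicVec G (u 0) ∧ ¬ IsCyclicVec G (u 1)}.ncard ≤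
      Fintype.card F ^ (k + 2) * (secondNonCyclic F k G.charpoly).ncard := by
  rw [← card_fin_fun, ← Set.ncard_univ, ← Set.ncard_prod]
  have key : ∀ u, u ∈ frames G → (of u)ᵀ.det ≠ 0 ∧ ∃ P, (of u)ᵀ * parMat (k + 2) P = G * (of u)ᵀ :=
    fun u hu => (mem_frames_iff hG u).1 hu
  choose! hdet P hP using key
  refine Set.ncard_le_ncard_of_injOn (fun u => (u 0, P u)) ?_ ?_ (Set.toFinite _)
  · rintro u ⟨hu, h0, h1⟩
    refine ⟨trivial, ⟨charpoly_eq_of_mul_eq (hdet u hu) (hP u hu), ?_⟩, ?_⟩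
    · rw [firstVec_eq_single, ← isCyclicVec_apply_iff (hdet u hu) (hP u hu)]
      exact h0
    · rw [consZero_firstVec_eq_single, ← isCyclicVec_apply_iff (hdet u hu) (hP u hu)]
      exact h1
  · rintro u ⟨hu, h0, h1⟩ v ⟨hv, h0', h1'⟩ h
    simp only [Prod.mk.injEq] at h
    have hPv := hP v hv
    rw [← h.2] at hPv
    refine of_transpose_injective (intertwiner_ext
      ((isCyclicVec_apply_iff (hdet u hu) (hP u hu) 0).1 h0) (hP u hu) hPv ?_)
    rw [transpose_of_mulVec_single, transpose_of_mulVec_single, h.1]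

/-- Move the first factor of a factorization of `G` to the end. -/
noncomputable def rotateFrame {m : ℕ} (G : Matrix (Fin (m + 1)) (Fin (m + 1)) F)
    (u : Fin (m + 1) → Fin (m + 1) → F) : Fin (m + 1) → Fin (m + 1) → F :=
  Fin.snoc (α := fun _ => Fin (m + 1) → F) (fun i => u i.succ) (G⁻¹ *ᵥ u 0)

theorem rotateFrame_castSucc {m : ℕ} (G : Matrix (Fin (m + 1)) (Fin (m + 1)) F)
    (u : Fin (m + 1) → Fin (m + 1) → F) (i : Fin m) :
    rotateFrame G u i.castSucc = u i.succ := by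
  simp [rotateFrame]

theorem rotateFrame_last {m : ℕ} (G : Matrix (Fin (m + 1)) (Fin (m + 1)) F)
    (u : Fin (m + 1) → Fin (m + 1) → F) :
    rotateFrame G u (Fin.last m) = G⁻¹ *ᵥ u 0 := by
  simp [rotateFrame]

theorem rotateFrame_injective {m : ℕ} {G : Matrix (Fin (m + 1)) (Fin (m + 1)) F}
    (hG : G.det = 1) : Function.Injective (rotateFrame G) := by
  intro u v h
  have hinv : IsUnit G⁻¹ := by
    rw [Matrix.isUnit_iff_isUnit_det, det_nonsing_inv, hG]; simp
  ext1 i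
  refine Fin.cases ?_ (fun i => ?_) i
  · have := congrFun h (Fin.last m)
    rw [rotateFrame_last, rotateFrame_last] at this
    exact mulVec_injective_iff_isUnit.2 hinv this
  · have := congrFun h i.castSucc
    rwa [rotateFrame_castSucc, rotateFrame_castSucc] at this

theorem rotateFrame_mem {m : ℕ} {G : Matrix (Fin (m + 1)) (Fin (m + 1)) F} (hG : G.det = 1)
    {u : Fin (m + 1) → Fin (m + 1) → F} (hu : u ∈ frames G) : rotateFrame G u ∈ frames G := by
  obtain ⟨φ, hφ, h⟩ := hu
  have hinv : G⁻¹ * G = 1 := nonsing_inv_mul _ (by rw [hG]; exact isUnit_one)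
  refine ⟨Fin.snoc (α := fun _ => Fin (m + 1) → F) (fun i => φ i.succ) (φ 0 ᵥ* G), ?_, ?_⟩
  · intro i
    refine Fin.lastCases ?_ (fun i => ?_) i
    · rw [rotateFrame_last, Fin.snoc_last, dotProduct_mulVec, vecMul_vecMul,
        mul_eq_one_comm.1 hinv, vecMul_one, hφ]
    · rw [rotateFrame_castSucc, Fin.snoc_castSucc, hφ]
  · rw [factorProd_castSucc]
    simp only [rotateFrame_last, rotateFrame_castSucc, Fin.snoc_last, Fin.snoc_castSucc]
    rw [factorProd_succ] at h
    set B := factorProd (fun i : Fin m => u i.succ) fun i => φ i.succ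
    have hB : B = (1 - vecMulVec (u 0) (φ 0)) * G := by
      rw [← h, ← Matrix.mul_assoc, mul_eq_one_comm.1 (one_add_vecMulVec_mul (hφ 0)),
        Matrix.one_mul]
    have hc : 1 + vecMulVec (G⁻¹ *ᵥ u 0) (φ 0 ᵥ* G) = G⁻¹ * (1 + vecMulVec (u 0) (φ 0)) * G := by
      rw [← mul_vecMulVec, ← vecMulVec_mul, Matrix.mul_add, Matrix.add_mul, Matrix.mul_one, hinv,
        Matrix.mul_assoc]
    rw [hc, hB]
    calc (1 - vecMulVec (u 0) (φ 0)) * G * (G⁻¹ * (1 + vecMulVec (u 0) (φ 0)) * G)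
        = (1 - vecMulVec (u 0) (φ 0)) * (G * G⁻¹) * (1 + vecMulVec (u 0) (φ 0)) * G := by
          simp only [Matrix.mul_assoc]
      _ = G := by
          rw [mul_eq_one_comm.1 hinv, Matrix.mul_one,
            mul_eq_one_comm.1 (one_add_vecMulVec_mul (hφ 0)), Matrix.one_mul]

theorem ncard_frames_not_cyclic_cyclic_le [Finite F] {k : ℕ}
    {G : Matrix (Fin (k + 2)) (Fin (k + 2)) F} (hG : G.det = 1) :
    {u ∈ frames G | ¬ IsCyclicVec G (u 0) ∧ IsCyclicVec G (u 1)}.ncard ≤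
      {u ∈ frames G | IsCyclicVec G (u 0) ∧ ¬ IsCyclicVec G (u 1)}.ncard := by
  have h1 : {u ∈ frames G | IsCyclicVec G (u 1)}.ncard ≤
      {u ∈ frames G | IsCyclicVec G (u 0)}.ncard := by
    refine Set.ncard_le_ncard_of_injOn (rotateFrame G) (fun u hu => ⟨rotateFrame_mem hG hu.1, ?_⟩)
      (rotateFrame_injective hG).injOn (Set.toFinite _)
    have := rotateFrame_castSucc G u 0
    rw [Fin.castSucc_zero, Fin.succ_zero_eq_one] at this
    rw [this]
    exact hu.2
  have h2 := Set.ncard_inter_add_ncard_sdiff_eq_ncard {u ∈ frames G | IsCyclicVec G (u 1)}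
    {u ∈ frames G | IsCyclicVec G (u 0)} (Set.toFinite _)
  have h3 := Set.ncard_inter_add_ncard_sdiff_eq_ncard {u ∈ frames G | IsCyclicVec G (u 0)}
    {u ∈ frames G | IsCyclicVec G (u 1)} (Set.toFinite _)
  rw [Set.inter_comm] at h3
  have h4 : {u ∈ frames G | ¬ IsCyclicVec G (u 0) ∧ IsCyclicVec G (u 1)} =
      {u ∈ frames G | IsCyclicVec G (u 1)} \ {u ∈ frames G | IsCyclicVec G (u 0)} := by
    ext u; simp only [Set.mem_ofPred_eq, Set.mem_sdiff]; tauto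
  have h5 : {u ∈ frames G | IsCyclicVec G (u 0) ∧ ¬ IsCyclicVec G (u 1)} =
      {u ∈ frames G | IsCyclicVec G (u 0)} \ {u ∈ frames G | IsCyclicVec G (u 1)} := by
    ext u; simp only [Set.mem_ofPred_eq, Set.mem_sdiff]; tauto
  rw [h4, h5]
  omega

theorem ncard_frames_step_le [Finite F] {k : ℕ} {G : Matrix (Fin (k + 2)) (Fin (k + 2)) F}
    (hG : G.det = 1) (j : ℕ) (hj : j < k + 1) :
    {u ∈ frames G | ¬ IsCyclicVec G (u (Fin.castSucc ⟨j, hj⟩)) ∧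
        IsCyclicVec G (u (Fin.succ ⟨j, hj⟩))}.ncard ≤
      {u ∈ frames G | ¬ IsCyclicVec G (u 0) ∧ IsCyclicVec G (u 1)}.ncard := by
  induction j with
  | zero => exact le_rfl
  | succ j ih =>
    refine le_trans ?_ (ih (by omega))
    refine Set.ncard_le_ncard_of_injOn (rotateFrame G) (fun u hu => ⟨rotateFrame_mem hG hu.1, ?_⟩)
      (rotateFrame_injective hG).injOn (Set.toFinite _)
    have h1 := rotateFrame_castSucc G u ⟨j, by omega⟩
    have h2 := rotateFrame_castSucc G u ⟨j + 1, hj⟩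
    have e : (Fin.succ ⟨j, by omega⟩ : Fin (k + 2)) = Fin.castSucc ⟨j + 1, hj⟩ := rfl
    rw [h1, e, h2]
    exact hu.2

end Frames

section FrameCount

variable {F : Type} [Field F]

theorem ncard_setOf_forall {α : Type} [Finite α] (n : ℕ) (p : α → Prop) :
    {u : Fin n → α | ∀ i, p (u i)}.ncard = {a | p a}.ncard ^ n := by
  rw [← Nat.card_coe_set_eq, ← Nat.card_coe_set_eq]
  have e : {u : Fin n → α // ∀ i, p (u i)} ≃ (Fin n → {a // p a}) :=
    Equiv.subtypePiEquivPi (p := fun _ => p)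
  exact (Nat.card_congr e).trans (by rw [Nat.card_fun]; simp; rfl)

theorem frames_subset {k : ℕ} (G : Matrix (Fin (k + 2)) (Fin (k + 2)) F) :
    frames G ⊆ ({u ∈ frames G | IsCyclicVec G (u 0)} ∪
      ⋃ j : Fin (k + 1), {u ∈ frames G | ¬ IsCyclicVec G (u j.castSucc) ∧
        IsCyclicVec G (u j.succ)}) ∪ {u | ∀ i, ¬ IsCyclicVec G (u i)} := by
  intro u hu
  by_contra h
  simp only [Set.mem_union, Set.mem_iUnion, Set.mem_ofPred_eq, not_or, not_exists, not_and] at h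
  obtain ⟨⟨h0, h1⟩, h2⟩ := h
  refine h2 fun i => ?_
  induction i using Fin.induction with
  | zero => exact h0 hu
  | succ j ih => exact h1 j hu ih

variable [Fintype F]

theorem ncard_frames_le {k : ℕ} {G : Matrix (Fin (k + 2)) (Fin (k + 2)) F}
    (hG : (G - 1).det ≠ 0) (hdet : G.det = 1) (hsq : Squarefree G.charpoly) :
    Fintype.card F * (frames G).ncard ≤
      (Fintype.card F + ((k + 1) * (k ^ 2 + k + 2) + (k + 2) ^ (k + 2))) *
        Fintype.card F ^ (k + 2 + (k + 1) ^ 2) := by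
  have hf1 : G.charpoly.eval 1 ≠ 0 := by
    rw [eval_charpoly, ← neg_sub, det_neg]
    simpa using hG
  have hf0 : G.charpoly.coeff 0 = (-1) ^ (k + 1 + 1) := by
    have := det_eq_sign_charpoly_coeff G
    rw [hdet, Fintype.card_fin] at this
    have h2 := congrArg (fun x => (-1) ^ (k + 2) * x) this
    simp only [← mul_assoc, ← mul_pow] at h2
    simpa using h2.symm
  have h1 := ncard_cyclicParWith (F := F) (charpoly_monic G)
    (by rw [charpoly_natDegree_eq_dim, Fintype.card_fin]) hf0
  have hbad := ncard_not_isCyclicVec_le_of_dvd G (charpoly_dvd_of_squarefree G hsq)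
  rw [Fintype.card_fin] at hbad
  have hsub := (Set.ncard_le_ncard (frames_subset G) (Set.toFinite _)).trans
    ((Set.ncard_union_le _ _).trans (Nat.add_le_add_right (Set.ncard_union_le _ _) _))
  have hall : {u : Fin (k + 2) → Fin (k + 2) → F | ∀ i, ¬ IsCyclicVec G (u i)}.ncard =
      {v | ¬ IsCyclicVec G v}.ncard ^ (k + 2) :=
    ncard_setOf_forall (k + 2) fun v => ¬ IsCyclicVec G v
  rw [ncard_frames_cyclic hG, hall] at hsub
  have hstep : (⋃ j : Fin (k + 1), {u ∈ frames G | ¬ IsCyclicVec G (u j.castSucc) ∧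
        IsCyclicVec G (u j.succ)}).ncard ≤
      (k + 1) * (Fintype.card F ^ (k + 2) * (secondNonCyclic F k G.charpoly).ncard) := by
    refine (Set.ncard_iUnion_le_of_fintype _).trans ((Finset.sum_le_card_nsmul _ _ _ fun j _ =>
      (ncard_frames_step_le hdet j.1 j.2).trans ((ncard_frames_not_cyclic_cyclic_le hdet).trans
        (ncard_frames_cyclic_not_cyclic_le hG))).trans ?_)
    simp
  have hsec := card_mul_ncard_secondNonCyclic_le (F := F) (k := k) hf1
  have hcyc : {v | IsCyclicVec G v}.ncard ≤ Fintype.card F ^ (k + 2) := by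
    rw [← card_fin_fun]
    exact (Set.ncard_le_ncard (Set.subset_univ _) (Set.toFinite _)).trans (Set.ncard_univ _).le
  set q := Fintype.card F
  set S := (secondNonCyclic F k G.charpoly).ncard
  calc q * (frames G).ncard
      ≤ q * (q ^ (k + 2) * q ^ ((k + 1) ^ 2) + (k + 1) * (q ^ (k + 2) * S) +
          ((k + 2) * q ^ (k + 2 - 1)) ^ (k + 2)) := by
        refine Nat.mul_le_mul_left _ (hsub.trans ?_)
        gcongr
        omega
    _ = q * q ^ (k + 2 + (k + 1) ^ 2) + (k + 1) * q ^ (k + 2) * (q * S) +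
          (k + 2) ^ (k + 2) * q ^ (k + 2 + (k + 1) ^ 2) := by
        rw [show k + 2 - 1 = k + 1 by omega, mul_pow, ← pow_mul]
        ring
    _ ≤ q * q ^ (k + 2 + (k + 1) ^ 2) +
          (k + 1) * q ^ (k + 2) * ((k ^ 2 + k + 2) * q ^ ((k + 1) ^ 2)) +
          (k + 2) ^ (k + 2) * q ^ (k + 2 + (k + 1) ^ 2) := by
        gcongr
    _ = _ := by ring

theorem le_ncard_frames {k : ℕ} {G : Matrix (Fin (k + 2)) (Fin (k + 2)) F}
    (hG : (G - 1).det ≠ 0) (hdet : G.det = 1) (hsq : Squarefree G.charpoly) :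
    Fintype.card F * Fintype.card F ^ (k + 2 + (k + 1) ^ 2) ≤
      Fintype.card F * (frames G).ncard +
        (k + 2 + (k + 1) ^ 2) * Fintype.card F ^ (k + 2 + (k + 1) ^ 2) := by
  have hf0 : G.charpoly.coeff 0 = (-1) ^ (k + 1 + 1) := by
    have := det_eq_sign_charpoly_coeff G
    rw [hdet, Fintype.card_fin] at this
    have h2 := congrArg (fun x => (-1) ^ (k + 2) * x) this
    simp only [← mul_assoc, ← mul_pow] at h2
    simpa using h2.symm
  have h1 := ncard_cyclicParWith (F := F) (charpoly_monic G)
    (by rw [charpoly_natDegree_eq_dim, Fintype.card_fin]) hf0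
  have hbad := ncard_not_isCyclicVec_le_of_dvd G (charpoly_dvd_of_squarefree G hsq)
  rw [Fintype.card_fin] at hbad
  have hle : {u ∈ frames G | IsCyclicVec G (u 0)}.ncard ≤ (frames G).ncard :=
    Set.ncard_le_ncard (fun u hu => hu.1) (Set.toFinite _)
  rw [ncard_frames_cyclic hG] at hle
  have hN := card_mul_ncard_nonCyclicPairs_le (F := F) (k + 1)
  have hcyc : {v | IsCyclicVec G v}.ncard + {v | ¬ IsCyclicVec G v}.ncard =
      Fintype.card F ^ (k + 2) := by
    rw [← card_fin_fun, ← Set.ncard_add_ncard_compl {v | IsCyclicVec G v}]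
    rfl
  set q := Fintype.card F
  set x := {v | IsCyclicVec G v}.ncard
  set y := {v | ¬ IsCyclicVec G v}.ncard
  set X := (cyclicParWith F (k + 1) G.charpoly).ncard
  set Y := (nonCyclicPairs F (k + 1)).ncard
  have hy : q * y ≤ (k + 2) * q ^ (k + 2) := by
    calc q * y ≤ q * ((k + 2) * q ^ (k + 2 - 1)) := Nat.mul_le_mul_left _ hbad
      _ = _ := by rw [show k + 2 - 1 = k + 1 by omega]; ring
  calc q * q ^ (k + 2 + (k + 1) ^ 2) = q * (x * X) + (q * y) * X + q ^ (k + 2) * (q * Y) := by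
        rw [pow_add, ← h1, ← hcyc]; ring
    _ ≤ q * (frames G).ncard + ((k + 2) * q ^ (k + 2)) * q ^ ((k + 1) ^ 2) +
          q ^ (k + 2) * ((k + 1) ^ 2 * q ^ ((k + 1) ^ 2)) := by
        gcongr
        omega
    _ = _ := by ring

end FrameCount

section TransvectionClass

variable {F : Type} [Field F] {n : ℕ}

theorem det_updateCol_one (j : Fin n) (u : Fin n → F) :
    ((1 : Matrix (Fin n) (Fin n) F).updateCol j u).det = u j := by
  rw [← cramer_apply, cramer_one, Module.End.one_apply]

theorem exists_det_ne_zero_mulVec_single {u : Fin n → F} (hu : u ≠ 0) (i : Fin n) :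
    ∃ P : Matrix (Fin n) (Fin n) F, P.det ≠ 0 ∧ P *ᵥ Pi.single i 1 = u := by
  obtain ⟨j, hj⟩ := Function.ne_iff.1 hu
  refine ⟨((1 : Matrix (Fin n) (Fin n) F).updateCol j u).submatrix id (Equiv.swap i j), ?_, ?_⟩
  · rw [det_permute', det_updateCol_one]
    refine mul_ne_zero ?_ hj
    obtain h | h := Int.units_eq_one_or (Equiv.Perm.sign (Equiv.swap i j)) <;> simp [h]
  · ext a
    simp

theorem exists_det_ne_zero_single_vecMul {φ : Fin n → F} (hφ : φ ≠ 0) {i j : Fin n} (hij : i ≠ j)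
    (hi : φ i = 0) :
    ∃ P : Matrix (Fin n) (Fin n) F, P.det ≠ 0 ∧ Pi.single j 1 ᵥ* P = φ ∧
      P *ᵥ Pi.single i 1 = Pi.single i 1 := by
  obtain ⟨l, hl⟩ := Function.ne_iff.1 hφ
  have hil : i ≠ l := by
    rintro rfl
    exact hl hi
  refine ⟨((1 : Matrix (Fin n) (Fin n) F).updateRow l φ).submatrix (Equiv.swap j l) id, ?_, ?_, ?_⟩
  · rw [det_permute, ← det_transpose, ← updateCol_transpose, transpose_one, det_updateCol_one]
    refine mul_ne_zero ?_ hl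
    obtain h | h := Int.units_eq_one_or (Equiv.Perm.sign (Equiv.swap j l)) <;> simp [h]
  · ext a
    simp
  · ext a
    simp only [mulVec_single, MulOpposite.op_one, one_smul, col_apply, submatrix_apply, id_eq]
    by_cases h1 : a = j
    · subst h1
      simp [hij.symm, hi]
    by_cases h2 : a = l
    · subst h2
      rw [Equiv.swap_apply_right, updateRow_ne (Ne.symm h1)]
      simp [one_apply, hij.symm, hil.symm]
    rw [Equiv.swap_apply_of_ne_of_ne h1 h2, updateRow_ne h2]
    simp [one_apply, Pi.single_apply]

theorem exists_specialLinearGroup_mulVec_vecMul {u φ : Fin n → F} (hu : u ≠ 0) (hφ : φ ≠ 0)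
    (h : φ ⬝ᵥ u = 0) {i j l : Fin n} (hij : i ≠ j) (hil : i ≠ l) (hjl : j ≠ l) :
    ∃ S : SpecialLinearGroup (Fin n) F, (S : Matrix (Fin n) (Fin n) F) *ᵥ Pi.single i 1 = u ∧
      φ ᵥ* (S : Matrix (Fin n) (Fin n) F) = Pi.single j 1 := by
  obtain ⟨P, hP, hPu⟩ := exists_det_ne_zero_mulVec_single hu i
  have hφP : φ ᵥ* P ≠ 0 := fun h0 => hφ (eq_zero_of_vecMul_eq_zero hP h0)
  have hi : (φ ᵥ* P) i = 0 := by
    rw [← h, ← hPu, dotProduct_mulVec, dotProduct_single, mul_one]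
  obtain ⟨R, hR, hRφ, hRi⟩ := exists_det_ne_zero_single_vecMul hφP hij hi
  have hRu : IsUnit R.det := isUnit_iff_ne_zero.2 hR
  have hdet : (P * R⁻¹).det ≠ 0 := by
    rw [det_mul, det_nonsing_inv, Ring.inverse_eq_inv']
    exact mul_ne_zero hP (inv_ne_zero hR)
  set D : Matrix (Fin n) (Fin n) F := diagonal (Function.update 1 l (P * R⁻¹).det⁻¹)
  refine ⟨⟨P * R⁻¹ * D, ?_⟩, ?_, ?_⟩
  · rw [det_mul, det_diagonal, Finset.prod_update_of_mem (Finset.mem_univ _)]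
    have hP' := left_ne_zero_of_mul ((det_mul P R⁻¹).symm ▸ hdet)
    simp
    field_simp
  · have hD : D *ᵥ Pi.single i 1 = Pi.single i 1 := by
      simp [D, hil]
    have hRi' : R⁻¹ *ᵥ Pi.single i 1 = Pi.single i 1 := by
      conv_lhs => rw [← hRi]
      rw [mulVec_mulVec, nonsing_inv_mul _ hRu, one_mulVec]
    rw [← mulVec_mulVec, ← mulVec_mulVec, hD, hRi', hPu]
  · have hD : Pi.single j 1 ᵥ* D = Pi.single j 1 := by
      simp [D, hjl]
    rw [← vecMul_vecMul, ← vecMul_vecMul, ← hRφ, vecMul_vecMul _ R, mul_nonsing_inv _ hRu,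
      vecMul_one, hD]

theorem isConj_transvectionSL_iff (hn : 3 ≤ n) (x : SpecialLinearGroup (Fin n) F) :
    IsConj (transvectionSL F n hn) x ↔ ∃ u φ : Fin n → F, u ≠ 0 ∧ φ ≠ 0 ∧ φ ⬝ᵥ u = 0 ∧
      (x : Matrix (Fin n) (Fin n) F) = 1 + vecMulVec u φ := by
  set i : Fin n := ⟨0, by omega⟩
  set j : Fin n := ⟨1, by omega⟩
  set l : Fin n := ⟨2, by omega⟩
  have hij : i ≠ j := by simp [i, j]
  have hT : (transvectionSL F n hn : Matrix (Fin n) (Fin n) F) =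
      1 + vecMulVec (Pi.single i 1) (Pi.single j 1) := by
    rw [← single_eq_single_vecMulVec_single]
    rfl
  have key (S : SpecialLinearGroup (Fin n) F) :
      ((S * transvectionSL F n hn * S⁻¹ : SpecialLinearGroup (Fin n) F) :
        Matrix (Fin n) (Fin n) F) = 1 + vecMulVec
          ((S : Matrix (Fin n) (Fin n) F) *ᵥ Pi.single i 1)
          (Pi.single j 1 ᵥ* ((S⁻¹ : SpecialLinearGroup (Fin n) F) : Matrix (Fin n) (Fin n) F)) := by
    refine (congrArg (fun A => (S : Matrix (Fin n) (Fin n) F) * A * S⁻¹.1) hT).trans ?_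
    rw [mul_add, add_mul, mul_one, mul_vecMulVec, vecMulVec_mul]
    exact congrArg (· + _) (congrArg Subtype.val (mul_inv_cancel S))
  rw [isConj_iff]
  constructor
  · rintro ⟨S, rfl⟩
    refine ⟨_, _, ?_, ?_, ?_, key S⟩
    · intro h
      have := eq_zero_of_mulVec_eq_zero (by simp) h
      simp at this
    · intro h
      have := eq_zero_of_vecMul_eq_zero (SpecialLinearGroup.det_ne_zero S⁻¹) h
      simp at this
    · rw [dotProduct_mulVec, vecMul_vecMul]
      refine (congrArg (fun A => (Pi.single j 1 ᵥ* A) ⬝ᵥ Pi.single i 1)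
        (congrArg Subtype.val (inv_mul_cancel S))).trans ?_
      simp [hij]
  · rintro ⟨u, φ, hu, hφ, h, hx⟩
    obtain ⟨S, hS, hS'⟩ := exists_specialLinearGroup_mulVec_vecMul hu hφ h hij
      (show i ≠ l by simp [i, l]) (show j ≠ l by simp [j, l])
    refine ⟨S, Subtype.ext ((key S).trans ?_)⟩
    rw [hx, hS, ← hS', vecMul_vecMul]
    refine (congrArg (fun A => 1 + vecMulVec u (φ ᵥ* A))
      (congrArg Subtype.val (mul_inv_cancel S))).trans ?_
    simp

theorem exists_units_smul_of_vecMulVec_eq {u φ u' φ' : Fin n → F} (hu : u ≠ 0) (hφ : φ ≠ 0)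
    (h : vecMulVec u φ = vecMulVec u' φ') : ∃ a : Fˣ, u' = a • u ∧ φ' = a⁻¹ • φ := by
  obtain ⟨i, hi⟩ := Function.ne_iff.1 hu
  obtain ⟨j, hj⟩ := Function.ne_iff.1 hφ
  have H (i j) : u i * φ j = u' i * φ' j := congrFun₂ h i j
  rw [Pi.zero_apply] at hi hj
  have h0 : u' i * φ' j ≠ 0 := by
    rw [← H]
    exact mul_ne_zero hi hj
  have hi' := left_ne_zero_of_mul h0
  have hj' := right_ne_zero_of_mul h0
  refine ⟨Units.mk0 (φ j / φ' j) (div_ne_zero hj hj'), ?_, ?_⟩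
  · ext a
    simp only [Pi.smul_apply, Units.smul_def, Units.val_mk0, smul_eq_mul]
    field_simp
    rw [← H, mul_comm]
  · ext b
    simp only [Pi.smul_apply, Units.smul_def, Units.val_inv_eq_inv_val, Units.val_mk0, smul_eq_mul]
    field_simp
    apply mul_left_cancel₀ hi
    apply mul_left_cancel₀ hi'
    linear_combination (u' i * φ' b) * H i j - (u' i * φ' j) * H i b

theorem vecMulVec_smul_inv_smul (a : Fˣ) (u φ : Fin n → F) :
    vecMulVec (a • u) (a⁻¹ • φ) = vecMulVec u φ := by
  ext i j
  simp only [vecMulVec_apply, Pi.smul_apply, Units.smul_def, smul_eq_mul]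
  rw [mul_mul_mul_comm, Units.mul_inv, one_mul]

theorem inv_smul_dotProduct_smul (a : Fˣ) (u φ : Fin n → F) :
    (a⁻¹ • φ) ⬝ᵥ (a • u) = φ ⬝ᵥ u := by
  rw [dotProduct_comm, dotProduct_comm φ, ← trace_vecMulVec, ← trace_vecMulVec,
    vecMulVec_smul_inv_smul]

end TransvectionClass

section TransvectionCount

variable {F : Type} [Field F] {n : ℕ}

/-- The pairs `(u, φ)` for which `1 + u φ` is a transvection. -/
def transvectionPairs (F : Type) [Field F] (n : ℕ) : Set ((Fin n → F) × (Fin n → F)) :=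
  {p | p.1 ≠ 0 ∧ p.2 ≠ 0 ∧ p.2 ⬝ᵥ p.1 = 0}

theorem smul_mem_transvectionPairs {p : (Fin n → F) × (Fin n → F)}
    (hp : p ∈ transvectionPairs F n) (a : Fˣ) : (a • p.1, a⁻¹ • p.2) ∈ transvectionPairs F n :=
  ⟨by simpa [Units.smul_def] using hp.1, by simpa [Units.smul_def] using hp.2.1,
    (inv_smul_dotProduct_smul a p.1 p.2).trans hp.2.2⟩

theorem units_smul_injective {u : Fin n → F} (hu : u ≠ 0) {a b : Fˣ} (h : a • u = b • u) :
    a = b := by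
  obtain ⟨i, hi⟩ := Function.ne_iff.1 hu
  exact Units.ext (mul_right_cancel₀ hi (congrFun h i))

theorem exists_transvectionPairs_section (hn : 3 ≤ n) :
    ∃ r : {x : SpecialLinearGroup (Fin n) F // IsConj (transvectionSL F n hn) x} →
      (Fin n → F) × (Fin n → F), ∀ x, r x ∈ transvectionPairs F n ∧
        x.1.1 = 1 + vecMulVec (r x).1 (r x).2 := by
  choose u φ hu hφ h hx using
    fun x : {x : SpecialLinearGroup (Fin n) F // IsConj (transvectionSL F n hn) x} =>
      (isConj_transvectionSL_iff hn x.1).1 x.2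
  exact ⟨fun x => (u x, φ x), fun x => ⟨⟨hu x, hφ x, h x⟩, hx x⟩⟩

theorem exists_isConj_of_mem_transvectionPairs (hn : 3 ≤ n) {p : (Fin n → F) × (Fin n → F)}
    (hp : p ∈ transvectionPairs F n) :
    ∃ x : {x : SpecialLinearGroup (Fin n) F // IsConj (transvectionSL F n hn) x},
      x.1.1 = 1 + vecMulVec p.1 p.2 := by
  have hdet : (1 + vecMulVec p.1 p.2).det = 1 := by
    rw [vecMulVec_eq Unit, det_one_add_replicateCol_mul_replicateRow, hp.2.2, add_zero]
  exact ⟨⟨⟨_, hdet⟩, (isConj_transvectionSL_iff hn _).2 ⟨p.1, p.2, hp.1, hp.2.1, hp.2.2, rfl⟩⟩, rfl⟩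

theorem ncard_transvectionPairs_eq (hn : 3 ≤ n) [Fintype F] :
    (transvectionPairs F n).ncard =
      Nat.card {x : SpecialLinearGroup (Fin n) F // IsConj (transvectionSL F n hn) x} *
        (Fintype.card F - 1) := by
  classical
  obtain ⟨r, hr⟩ := exists_transvectionPairs_section (F := F) hn
  rw [← Nat.card_eq_fintype_card (α := F), ← Nat.card_units, ← Nat.card_prod,
    ← Nat.card_coe_set_eq]
  symm
  refine Nat.card_congr (Equiv.ofBijective (fun y =>
    ⟨(y.2 • (r y.1).1, y.2⁻¹ • (r y.1).2), smul_mem_transvectionPairs (hr y.1).1 y.2⟩) ⟨?_, ?_⟩)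
  · rintro ⟨x, a⟩ ⟨y, b⟩ h
    have h' := Prod.ext_iff.1 (Subtype.ext_iff.1 h)
    dsimp only at h'
    have hxy : x = y := by
      refine Subtype.ext (Subtype.ext ?_)
      rw [(hr x).2, (hr y).2, ← vecMulVec_smul_inv_smul a, h'.1, h'.2, vecMulVec_smul_inv_smul]
    subst hxy
    rw [units_smul_injective (hr x).1.1 h'.1]
  · rintro ⟨p, hp⟩
    obtain ⟨x, hx⟩ := exists_isConj_of_mem_transvectionPairs hn hp
    obtain ⟨a, h1, h2⟩ := exists_units_smul_of_vecMulVec_eq (hr x).1.1 (hr x).1.2.1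
      (add_left_cancel ((hr x).2.symm.trans hx))
    exact ⟨(x, a), Subtype.ext (Prod.ext h1.symm h2.symm)⟩

theorem coe_prod_ofFn {l : ℕ} (t : Fin l → SpecialLinearGroup (Fin n) F) :
    (List.ofFn t).prod.1 = (List.ofFn fun i => (t i).1).prod := by
  induction l with
  | zero => rfl
  | succ l ih =>
    rw [List.ofFn_succ, List.ofFn_succ, List.prod_cons, List.prod_cons, ← ih]
    rfl

theorem ncard_frames_eq (hn : 3 ≤ n) [Fintype F] (g : SpecialLinearGroup (Fin n) F)
    (hg : (g.1 - 1).det ≠ 0) :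
    (frames g.1).ncard =
      Nat.card {t : Fin n → SpecialLinearGroup (Fin n) F //
        (∀ i, IsConj (transvectionSL F n hn) (t i)) ∧ (List.ofFn t).prod = g} *
        (Fintype.card F - 1) ^ n := by
  classical
  obtain ⟨r, hr⟩ := exists_transvectionPairs_section (F := F) hn
  have hpow : Nat.card (Fin n → Fˣ) = (Fintype.card F - 1) ^ n := by
    rw [Nat.card_fun, Nat.card_units, Nat.card_eq_fintype_card, Nat.card_eq_fintype_card,
      Fintype.card_fin]
  rw [← hpow, ← Nat.card_prod, ← Nat.card_coe_set_eq]
  symm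
  let R (t : {t : Fin n → SpecialLinearGroup (Fin n) F //
    (∀ i, IsConj (transvectionSL F n hn) (t i)) ∧ (List.ofFn t).prod = g}) (i : Fin n) :=
    r ⟨t.1 i, t.2.1 i⟩
  have hR (t i) : R t i ∈ transvectionPairs F n ∧
    (t.1 i).1 = 1 + vecMulVec (R t i).1 (R t i).2 := hr _
  have hprod (t) (a : Fin n → Fˣ) :
      factorProd (fun i => a i • (R t i).1) (fun i => (a i)⁻¹ • (R t i).2) = g.1 := by
    unfold factorProd
    rw [← t.2.2, coe_prod_ofFn]
    congr 2
    ext1 i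
    rw [vecMulVec_smul_inv_smul, (hR t i).2]
  have hzero (t) (a : Fin n → Fˣ) (i) : ((a i)⁻¹ • (R t i).2) ⬝ᵥ (a i • (R t i).1) = 0 :=
    (smul_mem_transvectionPairs (hR t i).1 (a i)).2.2
  refine Nat.card_congr (Equiv.ofBijective (fun y =>
    ⟨fun i => y.2 i • (R y.1 i).1, fun i => (y.2 i)⁻¹ • (R y.1 i).2, hzero y.1 y.2,
      hprod y.1 y.2⟩) ⟨?_, ?_⟩)
  · rintro ⟨t, a⟩ ⟨s, b⟩ h
    have h1 := Subtype.ext_iff.1 h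
    dsimp only at h1
    have h2 := factorProd_right_injective hg (hzero t a) (hprod t a) (h1 ▸ hprod s b)
    have hts : t = s := by
      refine Subtype.ext (funext fun i => Subtype.ext ?_)
      rw [(hR t i).2, (hR s i).2, ← vecMulVec_smul_inv_smul (a i), congrFun h1 i, congrFun h2 i,
        vecMulVec_smul_inv_smul]
    subst hts
    have : a = b := funext fun i => units_smul_injective (hR t i).1.1 (congrFun h1 i)
    rw [this]
  · rintro ⟨u, φ, hφ, hu⟩
    have hne := ne_zero_of_factorProd_eq hg hu
    choose x hx using fun i => exists_isConj_of_mem_transvectionPairs hn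
      (p := (u i, φ i)) ⟨(hne i).1, (hne i).2, hφ i⟩
    let t : {t : Fin n → SpecialLinearGroup (Fin n) F //
        (∀ i, IsConj (transvectionSL F n hn) (t i)) ∧ (List.ofFn t).prod = g} :=
      ⟨fun i => (x i).1, fun i => (x i).2, Subtype.ext (by
        rw [coe_prod_ofFn, ← hu]
        simp only [hx]
        rfl)⟩
    choose a ha using fun i => exists_units_smul_of_vecMulVec_eq (hR t i).1.1 (hR t i).1.2.1
      (add_left_cancel ((hR t i).2.symm.trans (hx i)))
    exact ⟨(t, a), Subtype.ext (funext fun i => (ha i).1.symm)⟩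

theorem ncard_dotProduct_eq_zero [Fintype F] {m : ℕ} {u : Fin (m + 1) → F} (hu : u ≠ 0) :
    {φ : Fin (m + 1) → F | φ ⬝ᵥ u = 0}.ncard = Fintype.card F ^ m := by
  let f : (Fin (m + 1) → F) →ₗ[F] F := (dotProductBilin F F).flip u
  have hf (φ) : f φ = φ ⬝ᵥ u := rfl
  have hne : f ≠ 0 := by
    obtain ⟨i, hi⟩ := Function.ne_iff.1 hu
    intro h
    refine hi ?_
    have := LinearMap.congr_fun h (Pi.single i 1)
    simpa [hf] using this
  have : Fintype (LinearMap.ker f) := Fintype.ofFinite _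
  have hrank := Module.Dual.finrank_ker_add_one_of_ne_zero hne
  rw [Module.finrank_fin_fun] at hrank
  have hker : {φ : Fin (m + 1) → F | φ ⬝ᵥ u = 0} = (LinearMap.ker f : Set (Fin (m + 1) → F)) := rfl
  rw [hker, ← Nat.card_coe_set_eq, SetLike.coe_sort_coe, Nat.card_eq_fintype_card,
    Module.card_eq_pow_finrank (K := F), Nat.add_right_cancel hrank]

theorem ncard_transvectionPairs [Fintype F] (m : ℕ) :
    (transvectionPairs F (m + 1)).ncard =
      (Fintype.card F ^ (m + 1) - 1) * (Fintype.card F ^ m - 1) := by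
  classical
  have e : transvectionPairs F (m + 1) ≃ Σ u : {u : Fin (m + 1) → F // u ≠ 0},
      {φ : Fin (m + 1) → F // φ ∈ {φ | φ ⬝ᵥ u.1 = 0} \ {0}} :=
    { toFun := fun p => ⟨⟨p.1.1, p.2.1⟩, ⟨p.1.2, p.2.2.2, p.2.2.1⟩⟩
      invFun := fun s => ⟨(s.1.1, s.2.1), s.1.2, s.2.2.2, s.2.2.1⟩
      left_inv := fun _ => rfl
      right_inv := fun _ => rfl }
  have h1 : Nat.card {u : Fin (m + 1) → F // u ≠ 0} = Fintype.card F ^ (m + 1) - 1 := by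
    rw [← card_fin_fun, Nat.card_eq_fintype_card, Fintype.card_subtype_compl,
      Nat.card_eq_fintype_card, Fintype.card_subtype_eq]
  have h2 (u : {u : Fin (m + 1) → F // u ≠ 0}) :
      Nat.card {φ : Fin (m + 1) → F // φ ∈ {φ | φ ⬝ᵥ u.1 = 0} \ {0}} =
        Fintype.card F ^ m - 1 := by
    rw [← ncard_dotProduct_eq_zero u.2, ← Set.ncard_sdiff_singleton_of_mem
      (show (0 : Fin (m + 1) → F) ∈ {φ | φ ⬝ᵥ u.1 = 0} from zero_dotProduct _),
      ← Nat.card_coe_set_eq]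
  rw [← Nat.card_coe_set_eq, Nat.card_congr e, Nat.card_sigma, Finset.sum_congr rfl fun u _ => h2 u,
    Finset.sum_const, Finset.card_univ, ← Nat.card_eq_fintype_card, h1, smul_eq_mul]

theorem card_specialLinearGroup_mul [Fintype F] (m : ℕ) :
    Nat.card (SpecialLinearGroup (Fin (m + 1)) F) =
      Fintype.card F ^ m * ∏ i : Fin m, (Fintype.card F ^ (m + 1) - Fintype.card F ^ (i : ℕ)) := by
  classical
  have hq : 1 < Fintype.card F := Fintype.one_lt_card
  have hGL : Nat.card (GL (Fin (m + 1)) F) =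
      Nat.card (SpecialLinearGroup (Fin (m + 1)) F) * (Fintype.card F - 1) := by
    rw [← Subgroup.card_mul_index (GeneralLinearGroup.det (n := Fin (m + 1)) (R := F)).ker,
      Subgroup.index_ker]
    congr 1
    · symm
      refine Nat.card_congr (Equiv.ofBijective (fun S => ⟨SpecialLinearGroup.toGL S, ?_⟩) ⟨?_, ?_⟩)
      · exact Units.ext S.2
      · intro S T h
        exact Subtype.ext (congrArg (fun x => x.1.1) h)
      · rintro ⟨x, hx⟩
        exact ⟨⟨x.1, congrArg Units.val hx⟩, Subtype.ext (Units.ext rfl)⟩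
    · rw [MonoidHom.range_eq_top.2, Subgroup.card_top, Nat.card_units, Nat.card_eq_fintype_card]
      intro a
      refine ⟨GeneralLinearGroup.mkOfDetNeZero (diagonal (Function.update 1 0 (a : F))) ?_, ?_⟩
      · rw [det_diagonal, Finset.prod_update_of_mem (Finset.mem_univ _)]
        simp
      · ext
        simp [GeneralLinearGroup.mkOfDetNeZero, Finset.prod_update_of_mem]
  rw [card_GL_field, Fin.prod_univ_castSucc] at hGL
  refine Nat.eq_of_mul_eq_mul_right (Nat.sub_pos_of_lt hq) (hGL.symm.trans ?_)
  simp only [Fin.val_castSucc, Fin.val_last]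
  rw [show Fintype.card F ^ (m + 1) - Fintype.card F ^ m =
    Fintype.card F ^ m * (Fintype.card F - 1) by rw [Nat.mul_sub, pow_succ, mul_one]]
  ring

end TransvectionCount

theorem abs_mul_div_sub_one_le {f s p a b c d x : ℝ} (hf : |f - 1| ≤ a * x) (hs0 : 0 ≤ s)
    (hs1 : s ≤ 1) (hs : 1 - b * x ≤ s) (hp1 : p ≤ 1) (hp : 1 - c * x ≤ p) (hd : 0 < d)
    (hpd : d ≤ p) : |f * s / p - 1| ≤ d⁻¹ * (a + b + c) * x := by
  have hp0 : 0 < p := hd.trans_le hpd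
  have h1 : f * s / p - 1 = ((f - 1) * s + (s - p)) / p := by
    field_simp
    ring
  have h2 : |(f - 1) * s| ≤ a * x := by
    rw [abs_mul, abs_of_nonneg hs0]
    exact (mul_le_of_le_one_right (abs_nonneg _) hs1).trans hf
  have h3 : |s - p| ≤ (b + c) * x := by
    rw [abs_le]
    constructor <;> linarith
  have h4 : |(f - 1) * s + (s - p)| ≤ (a + b + c) * x := by
    linarith [abs_add_le ((f - 1) * s) (s - p)]
  rw [h1, abs_div, abs_of_pos hp0, div_eq_inv_mul, mul_assoc]
  exact mul_le_mul (inv_anti₀ hd hpd) h4 (abs_nonneg _) (inv_nonneg.2 hd.le)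

section Asymptotics

variable {F : Type} [Field F] [Fintype F]

theorem two_le_card (F : Type) [Field F] [Fintype F] : (2 : ℝ) ≤ Fintype.card F := by
  exact_mod_cast Fintype.one_lt_card (α := F)

theorem inv_card_le_half (F : Type) [Field F] [Fintype F] :
    ((Fintype.card F : ℝ))⁻¹ ≤ 1 / 2 := by
  rw [one_div]
  exact inv_anti₀ two_pos (two_le_card F)

theorem one_sub_mul_inv_card_le_pow (l : ℕ) :
    1 - l * (Fintype.card F : ℝ)⁻¹ ≤ (1 - (Fintype.card F : ℝ)⁻¹) ^ l := by
  have := one_add_mul_le_pow (a := -(Fintype.card F : ℝ)⁻¹)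
    (by linarith [inv_card_le_half F]) l
  simpa [sub_eq_add_neg] using this

theorem abs_ncard_frames_div_sub_one_le {k : ℕ} {G : Matrix (Fin (k + 2)) (Fin (k + 2)) F}
    (hG : (G - 1).det ≠ 0) (hdet : G.det = 1) (hsq : Squarefree G.charpoly) :
    |((frames G).ncard : ℝ) / (Fintype.card F : ℝ) ^ (k + 2 + (k + 1) ^ 2) - 1| ≤
      (((k + 1) * (k ^ 2 + k + 2) + (k + 2) ^ (k + 2) + (k + 2 + (k + 1) ^ 2) : ℕ) : ℝ) *
        (Fintype.card F : ℝ)⁻¹ := by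
  have h1 := ncard_frames_le hG hdet hsq
  have h2 := le_ncard_frames hG hdet hsq
  generalize (k + 1) * (k ^ 2 + k + 2) + (k + 2) ^ (k + 2) = b at *
  generalize k + 2 + (k + 1) ^ 2 = c at *
  have hq : (0 : ℝ) < Fintype.card F := two_pos.trans_le (two_le_card F)
  rw [← Nat.cast_le (α := ℝ)] at h1 h2
  push_cast at h1 h2 ⊢
  generalize (Fintype.card F : ℝ) = q at *
  generalize ((frames G).ncard : ℝ) = N at *
  have hc : (0 : ℝ) < q ^ c := pow_pos hq c
  have hb0 : (0 : ℝ) ≤ b := b.cast_nonneg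
  have hc0 : (0 : ℝ) ≤ c := c.cast_nonneg
  rw [abs_le, ← div_eq_mul_inv]
  constructor
  · rw [neg_le_iff_add_nonneg]
    have : N / q ^ c - 1 + (b + c) / q =
        (q * N + c * q ^ c - q * q ^ c + b * q ^ c) / (q * q ^ c) := by
      field_simp
      ring
    rw [this]
    apply div_nonneg _ (by positivity)
    nlinarith [mul_nonneg hb0 hc.le]
  · rw [← sub_nonneg]
    have : (b + c) / q - (N / q ^ c - 1) = ((q + b) * q ^ c - q * N + c * q ^ c) / (q * q ^ c) := by
      field_simp
      ring
    rw [this]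
    apply div_nonneg _ (by positivity)
    nlinarith [mul_nonneg hc0 hc.le]

theorem card_specialLinearGroup_div (m : ℕ) :
    (Nat.card (SpecialLinearGroup (Fin (m + 1)) F) : ℝ) /
        (Fintype.card F : ℝ) ^ (m + (m + 1) * m) ≤ 1 ∧
      (1 - (Fintype.card F : ℝ)⁻¹) ^ m ≤ (Nat.card (SpecialLinearGroup (Fin (m + 1)) F) : ℝ) /
        (Fintype.card F : ℝ) ^ (m + (m + 1) * m) := by
  have hq : (0 : ℝ) < Fintype.card F := two_pos.trans_le (two_le_card F)
  have hq1 : (1 : ℝ) ≤ Fintype.card F := one_le_two.trans (two_le_card F)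
  have h : (Nat.card (SpecialLinearGroup (Fin (m + 1)) F) : ℝ) /
        (Fintype.card F : ℝ) ^ (m + (m + 1) * m) =
      ∏ i : Fin m, (1 - (Fintype.card F : ℝ) ^ (i : ℕ) / (Fintype.card F : ℝ) ^ (m + 1)) := by
    rw [card_specialLinearGroup_mul, Nat.cast_mul, Nat.cast_prod, pow_add _ m ((m + 1) * m),
      Nat.cast_pow,
      mul_div_mul_left _ _ (pow_pos hq m).ne', pow_mul, ← Fin.prod_const m (_ ^ (m + 1) : ℝ),
      ← Finset.prod_div_distrib]
    refine Finset.prod_congr rfl fun i _ => ?_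
    rw [Nat.cast_sub (Nat.pow_le_pow_right Fintype.card_pos (i.2.le.trans m.le_succ)), sub_div]
    push_cast
    rw [div_self (pow_pos hq _).ne']
  have hle (i : Fin m) : (Fintype.card F : ℝ) ^ (i : ℕ) / (Fintype.card F : ℝ) ^ (m + 1) ≤
      (Fintype.card F : ℝ)⁻¹ := by
    rw [div_le_iff₀ (pow_pos hq _), pow_succ', inv_mul_cancel_left₀ hq.ne']
    exact pow_le_pow_right₀ hq1 i.2.le
  have hhalf := inv_card_le_half F
  rw [h]
  constructor
  · refine Finset.prod_le_one (fun i _ => ?_) fun i _ => ?_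
    · linarith [hle i]
    · rw [sub_le_self_iff]
      positivity
  · rw [← Fin.prod_const]
    refine Finset.prod_le_prod (fun i _ => ?_) fun i _ => ?_
    · linarith
    · linarith [hle i]

theorem ncard_transvectionPairs_div {m : ℕ} (hm : m ≠ 0) :
    ((transvectionPairs F (m + 1)).ncard : ℝ) / (Fintype.card F : ℝ) ^ (2 * m + 1) ≤ 1 ∧
      (1 - (Fintype.card F : ℝ)⁻¹) ^ 2 ≤
        ((transvectionPairs F (m + 1)).ncard : ℝ) / (Fintype.card F : ℝ) ^ (2 * m + 1) := by
  have hq : (0 : ℝ) < Fintype.card F := two_pos.trans_le (two_le_card F)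
  have hq1 : (1 : ℝ) ≤ Fintype.card F := one_le_two.trans (two_le_card F)
  have h : ((transvectionPairs F (m + 1)).ncard : ℝ) / (Fintype.card F : ℝ) ^ (2 * m + 1) =
      (1 - ((Fintype.card F : ℝ)⁻¹) ^ (m + 1)) * (1 - ((Fintype.card F : ℝ)⁻¹) ^ m) := by
    rw [ncard_transvectionPairs, Nat.cast_mul, Nat.cast_sub (Nat.one_le_pow _ _ Fintype.card_pos),
      Nat.cast_sub (Nat.one_le_pow _ _ Fintype.card_pos)]
    push_cast
    rw [show 2 * m + 1 = (m + 1) + m by ring, pow_add _ (m + 1) m, mul_div_mul_comm, sub_div,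
      sub_div, div_self (pow_pos hq _).ne', div_self (pow_pos hq _).ne', one_div, one_div, inv_pow,
      inv_pow]
  have hx0 : (0 : ℝ) ≤ (Fintype.card F : ℝ)⁻¹ := by positivity
  have hx1 := inv_card_le_half F
  rw [h]
  generalize (Fintype.card F : ℝ)⁻¹ = x at *
  have hpow {l : ℕ} (hl : l ≠ 0) : x ^ l ≤ x := pow_le_of_le_one hx0 (by linarith) hl
  have h1 := hpow hm
  have h2 := hpow (Nat.add_one_ne_zero m)
  have h3 := pow_nonneg hx0 m
  have h4 := pow_nonneg hx0 (m + 1)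
  constructor
  · exact mul_le_one₀ (by linarith) (by linarith) (by linarith)
  · rw [sq]
    exact mul_le_mul (by linarith) (by linarith) (by linarith) (by linarith)

end Asymptotics

/-- fix `n ≥ 3`.  There is a constant `A_n > 0`, depending only on `n`, such
that for every finite field `F_q` and every regular semisimple `g ∈ SL_n(F_q)` with
`det(g − I) ≠ 0`, the number of `n`-tuples from the conjugacy class `C` of the transvection
whose product is `g` satisfies `|#(M_{n,g})·#SL_n(F_q)/#(C)^n − 1| ≤ A_n/q`. -/
theorem generation_count_boundary (n : ℕ) (hn : 3 ≤ n) :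
    ∃ A : ℝ, 0 < A ∧
      ∀ (F : Type) [Field F] [Fintype F],
        ∀ g : Matrix.SpecialLinearGroup (Fin n) F,
          Squarefree (Matrix.charpoly (g : Matrix (Fin n) (Fin n) F)) →
          ((g : Matrix (Fin n) (Fin n) F) - 1).det ≠ 0 →
          |(Nat.card {t : Fin n → Matrix.SpecialLinearGroup (Fin n) F //
                (∀ i, IsConj (transvectionSL F n hn) (t i)) ∧ (List.ofFn t).prod = g} : ℝ) *
              (Nat.card (Matrix.SpecialLinearGroup (Fin n) F) : ℝ) /
              (Nat.card {x : Matrix.SpecialLinearGroup (Fin n) F //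
                  IsConj (transvectionSL F n hn) x} : ℝ) ^ n
            - 1| ≤ A / (Fintype.card F : ℝ) := by
  obtain ⟨k, rfl⟩ : ∃ k, n = k + 2 := ⟨n - 2, by omega⟩
  let a : ℕ := (k + 1) * (k ^ 2 + k + 2) + (k + 2) ^ (k + 2) + (k + 2 + (k + 1) ^ 2)
  refine ⟨((1 / 2 : ℝ) ^ (2 * (k + 2)))⁻¹ * (a + (k + 1 : ℕ) + (2 * (k + 2) : ℕ)),
    by positivity, fun F _ _ g hsq hg => ?_⟩
  have hq : (0 : ℝ) < Fintype.card F := two_pos.trans_le (two_le_card F)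
  have hq1 : (0 : ℝ) < Fintype.card F - 1 := by linarith [two_le_card F]
  have hhalf := inv_card_le_half F
  have hf := abs_ncard_frames_div_sub_one_le hg g.2 hsq
  obtain ⟨hs1, hs⟩ := card_specialLinearGroup_div (F := F) (k + 1)
  obtain ⟨hp1, hp⟩ := ncard_transvectionPairs_div (F := F) (m := k + 1) k.succ_ne_zero
  have hp' := pow_le_pow_left₀ (sq_nonneg _) hp (k + 2)
  rw [← pow_mul] at hp'
  have key := abs_mul_div_sub_one_le hf (by positivity) hs1
    ((one_sub_mul_inv_card_le_pow (k + 1)).trans hs)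
    (pow_le_one₀ (n := k + 2) (by positivity) hp1)
    ((one_sub_mul_inv_card_le_pow (2 * (k + 2))).trans hp')
    (d := (1 / 2 : ℝ) ^ (2 * (k + 2))) (by positivity)
    ((pow_le_pow_left₀ (by norm_num) (by linarith) _).trans hp')
  rw [div_eq_mul_inv _ (Fintype.card F : ℝ)]
  refine le_trans (le_of_eq ?_) key
  have e1 := congrArg (Nat.cast (R := ℝ)) (ncard_frames_eq hn g hg)
  have e2 := congrArg (Nat.cast (R := ℝ)) (ncard_transvectionPairs_eq (F := F) hn)
  rw [Nat.cast_mul, Nat.cast_pow, Nat.cast_sub Fintype.card_pos, Nat.cast_one] at e1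
  rw [Nat.cast_mul, Nat.cast_sub Fintype.card_pos, Nat.cast_one] at e2
  rw [e1, e2]
  congr 2
  rw [div_mul_div_comm, div_pow, mul_pow, ← pow_add, ← pow_mul, div_div_div_eq,
    show k + 2 + (k + 1) ^ 2 + (k + 1 + (k + 1 + 1) * (k + 1)) =
      (2 * (k + 1) + 1) * (k + 2) by ring]
  rw [mul_comm ((Fintype.card F : ℝ) ^ _), mul_div_mul_right _ _ (pow_pos hq _).ne',
    mul_right_comm, mul_div_mul_right _ _ (pow_pos hq1 _).ne']
end
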